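/- Over the class of all Kripke trees, MTL < CoWMTL, WMTL < CoWMTL, MSO and CoWMTL are expressively incomparable, and WMSO and CoWMTL are expressively incomparable. Over the class of finitely-branching Kripke trees, MTL ≡ CoWMTL, WMTL < CoWMTL, and WMSO and CoWMTL are expressively incomparable. -/

import Mathlib

/-! ## Trees over ℕ* -/

abbrev Node : Type := List ℕ

/-- `T` is a tree with root `r`: `r ∈ T`, every node extends `r`, and `T` is
prefix-closed above `r`. -/
def IsTreeRooted (T : Set Node) (r : Node) : Prop :=
  r ∈ T ∧ (∀ τ ∈ T, r <+: τ) ∧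
    ∀ σ σ' : List ℕ, r ++ σ ∈ T → σ' <+: σ → r ++ σ' ∈ T

/-- `T ⊆ ℕ*` is a tree. -/
def IsTree (T : Set Node) : Prop := ∃ r : Node, IsTreeRooted T r

/-- `τ'` is a child of `τ` in `T`. -/
def childIn (T : Set Node) (τ τ' : Node) : Prop := τ' ∈ T ∧ ∃ n : ℕ, τ' = τ ++ [n]

/-- every node of `T` has a child in `T`. -/
def NonBlocking (T : Set Node) : Prop := ∀ τ ∈ T, ∃ n : ℕ, τ ++ [n] ∈ T

/-- every node of `T` has finitely many children in `T`. -/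
def FinBranching (T : Set Node) : Prop := ∀ τ ∈ T, {τ' : Node | childIn T τ τ'}.Finite

/-- `S` is a subtree of `T`. -/
def IsSubtree (T S : Set Node) : Prop := S ⊆ T ∧ IsTree S

/-- `P` is a path of `T`: a subtree totally ordered by the child relation
(each node has at most one child in `P`). -/
def IsPathOf (T P : Set Node) : Prop :=
  IsSubtree T P ∧ ∀ τ ∈ P, ∀ n m : ℕ, τ ++ [n] ∈ P → τ ++ [m] ∈ P → n = m

/-- `T` is a chain: a tree in which each node has at most one child. -/
def IsChainTree (T : Set Node) : Prop :=
  IsTree T ∧ ∀ τ ∈ T, ∀ n m : ℕ, τ ++ [n] ∈ T → τ ++ [m] ∈ T → n = m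

/-- `T` is dense: it contains a subtree every node of which has a descendant
in the subtree with at least two distinct children in the subtree. -/
def DenseTree (T : Set Node) : Prop :=
  ∃ S : Set Node, IsSubtree T S ∧ ∀ τ ∈ S, ∃ τ' ∈ S, τ <+: τ' ∧
    ∃ n m : ℕ, n ≠ m ∧ τ' ++ [n] ∈ S ∧ τ' ++ [m] ∈ S

/-- A Kripke tree over `AP`: a non-blocking tree together with a labelling. -/
structure KripkeTree (AP : Type) where
  T : Set Node
  root : Node
  rooted : IsTreeRooted T root
  nonblocking : NonBlocking T
  Lab : Node → Set AP

/-! ## MSOL syntax -/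

inductive MSOL (AP : Type) : Type
  | atom : AP → ℕ → MSOL AP          -- P_a(x)
  | le   : ℕ → ℕ → MSOL AP           -- x ≤ y
  | mem  : ℕ → ℕ → MSOL AP           -- x ∈ X
  | not  : MSOL AP → MSOL AP
  | and  : MSOL AP → MSOL AP → MSOL AP
  | exFO : ℕ → MSOL AP → MSOL AP     -- ∃x. φ
  | exSO : ℕ → MSOL AP → MSOL AP     -- ∃X. φ

namespace MSOL

def freeFO {AP : Type} : MSOL AP → Set ℕ
  | atom _ x => {x}
  | le x y => {x, y}
  | mem x _ => {x}
  | not φ => φ.freeFO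
  | and φ ψ => φ.freeFO ∪ ψ.freeFO
  | exFO x φ => φ.freeFO \ {x}
  | exSO _ φ => φ.freeFO

def freeSO {AP : Type} : MSOL AP → Set ℕ
  | atom _ _ => ∅
  | le _ _ => ∅
  | mem _ X => {X}
  | not φ => φ.freeSO
  | and φ ψ => φ.freeSO ∪ ψ.freeSO
  | exFO _ φ => φ.freeSO
  | exSO X φ => φ.freeSO \ {X}

/-- A sentence is a formula with no free variables. -/
def IsSentence {AP : Type} (φ : MSOL AP) : Prop := φ.freeFO = ∅ ∧ φ.freeSO = ∅

/-- The first-order fragment: no second-order variables. -/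
def IsFO {AP : Type} : MSOL AP → Prop
  | atom _ _ => True
  | le _ _ => True
  | mem _ _ => False
  | not φ => φ.IsFO
  | and φ ψ => φ.IsFO ∧ ψ.IsFO
  | exFO _ φ => φ.IsFO
  | exSO _ _ => False

end MSOL

/-! ## MSOL semantics, parametrized by the range of second-order quantifiers -/

/-- A second-order domain: for each tree, the collection of sets that
second-order quantifiers range over. -/
abbrev SODom : Type := Set Node → Set (Set Node)

def Sat {AP : Type} (D : SODom) (K : KripkeTree AP) :
    (ℕ → Node) → (ℕ → Set Node) → MSOL AP → Prop
  | V1, _,  .atom a x => V1 x ∈ K.T ∧ a ∈ K.Lab (V1 x)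
  | V1, _,  .le x y => V1 x ∈ K.T ∧ V1 y ∈ K.T ∧ V1 x <+: V1 y
  | V1, V2, .mem x X => V1 x ∈ V2 X
  | V1, V2, .not φ => ¬ Sat D K V1 V2 φ
  | V1, V2, .and φ ψ => Sat D K V1 V2 φ ∧ Sat D K V1 V2 ψ
  | V1, V2, .exFO x φ => ∃ τ ∈ K.T, Sat D K (Function.update V1 x τ) V2 φ
  | V1, V2, .exSO X φ => ∃ S ∈ D K.T, Sat D K V1 (Function.update V2 X S) φ

/-- A logic: a syntactic fragment of MSOL together with a second-order domain. -/
structure MLogic (AP : Type) where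
  syn : MSOL AP → Prop
  dom : SODom

namespace MLogic

/-- A Kripke tree satisfies a sentence. -/
def KSat {AP : Type} (L : MLogic AP) (K : KripkeTree AP) (φ : MSOL AP) : Prop :=
  ∃ V1 V2, Sat L.dom K V1 V2 φ

/-- `L ≤ L'` over the class `M`. -/
def Leq {AP : Type} (M : Set (KripkeTree AP)) (L L' : MLogic AP) : Prop :=
  ∀ φ : MSOL AP, φ.IsSentence → L.syn φ →
    ∃ φ' : MSOL AP, φ'.IsSentence ∧ L'.syn φ' ∧
      ∀ K ∈ M, (L.KSat K φ ↔ L'.KSat K φ')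

/-- `L < L'` over the class `M`. -/
def Lt {AP : Type} (M : Set (KripkeTree AP)) (L L' : MLogic AP) : Prop :=
  Leq M L L' ∧ ¬ Leq M L' L

/-- `L ≡ L'` over the class `M`. -/
def EquivExp {AP : Type} (M : Set (KripkeTree AP)) (L L' : MLogic AP) : Prop :=
  Leq M L L' ∧ Leq M L' L

/-- `L` and `L'` are expressively incomparable over the class `M`. -/
def Incomp {AP : Type} (M : Set (KripkeTree AP)) (L L' : MLogic AP) : Prop :=
  ¬ Leq M L L' ∧ ¬ Leq M L' L

end MLogic

/-! ## The concrete logics -/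

def MSOdom : SODom := fun T => {S | S ⊆ T}
def MTLdom : SODom := fun T => {S | S ⊆ T ∧ IsTree S}
def MPLdom : SODom := fun T => {S | IsPathOf T S}
def weakDom (D : SODom) : SODom := fun T => {S | S ∈ D T ∧ S.Finite}
def coweakDom (D : SODom) : SODom := fun T => {S | S ∈ D T ∧ S.Infinite}

def MSO (AP : Type) : MLogic AP := ⟨fun _ => True, MSOdom⟩
def MTL (AP : Type) : MLogic AP := ⟨fun _ => True, MTLdom⟩
def MPL (AP : Type) : MLogic AP := ⟨fun _ => True, MPLdom⟩
def WMSO (AP : Type) : MLogic AP := ⟨fun _ => True, weakDom MSOdom⟩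
def WMTL (AP : Type) : MLogic AP := ⟨fun _ => True, weakDom MTLdom⟩
def WMPL (AP : Type) : MLogic AP := ⟨fun _ => True, weakDom MPLdom⟩
def CoWMSO (AP : Type) : MLogic AP := ⟨fun _ => True, coweakDom MSOdom⟩
def CoWMTL (AP : Type) : MLogic AP := ⟨fun _ => True, coweakDom MTLdom⟩
def CoWMPL (AP : Type) : MLogic AP := ⟨fun _ => True, coweakDom MPLdom⟩
def FOL (AP : Type) : MLogic AP := ⟨MSOL.IsFO, MSOdom⟩

/-! ## Classes of Kripke trees -/

def allKT (AP : Type) : Set (KripkeTree AP) := Set.univ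
def finBrKT (AP : Type) : Set (KripkeTree AP) := {K | FinBranching K.T}
/-- Kripke trees whose underlying tree is an infinite chain
(every node has exactly one child). -/
def chainKT (AP : Type) : Set (KripkeTree AP) :=
  {K | ∀ τ ∈ K.T, ∃! τ' : Node, childIn K.T τ τ'}

set_option linter.unusedSimpArgs false

theorem Sat_congr {AP : Type} {D : SODom} {K : KripkeTree AP} (φ : MSOL AP) :
    ∀ V1 V1' V2 V2', (∀ x ∈ φ.freeFO, V1 x = V1' x) → (∀ X ∈ φ.freeSO, V2 X = V2' X) →
      (Sat D K V1 V2 φ ↔ Sat D K V1' V2' φ) := by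
  induction φ with
  | atom a x => intro V1 V1' V2 V2' h1 h2; simp [Sat, h1 x (by simp [MSOL.freeFO])]
  | le x y =>
    intro V1 V1' V2 V2' h1 h2
    simp [Sat, h1 x (by simp [MSOL.freeFO]), h1 y (by simp [MSOL.freeFO])]
  | mem x X =>
    intro V1 V1' V2 V2' h1 h2
    simp [Sat, h1 x (by simp [MSOL.freeFO]), h2 X (by simp [MSOL.freeSO])]
  | not φ ih =>
    intro V1 V1' V2 V2' h1 h2
    simp only [Sat]; rw [ih V1 V1' V2 V2' h1 h2]
  | and φ ψ ih ih' =>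
    intro V1 V1' V2 V2' h1 h2
    simp only [Sat]
    rw [ih V1 V1' V2 V2' (fun x hx => h1 x (Or.inl hx)) (fun x hx => h2 x (Or.inl hx)),
      ih' V1 V1' V2 V2' (fun x hx => h1 x (Or.inr hx)) (fun x hx => h2 x (Or.inr hx))]
  | exFO x φ ih =>
    intro V1 V1' V2 V2' h1 h2
    simp only [Sat]
    refine exists_congr fun τ => and_congr_right fun _ => ih _ _ _ _ ?_ h2
    intro y hy
    by_cases hxy : y = x
    · subst hxy; simp
    · simp [Function.update_of_ne hxy, h1 y ⟨hy, hxy⟩]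
  | exSO X φ ih =>
    intro V1 V1' V2 V2' h1 h2
    simp only [Sat]
    refine exists_congr fun τ => and_congr_right fun _ => ih _ _ _ _ h1 ?_
    intro y hy
    by_cases hxy : y = X
    · subst hxy; simp
    · simp [Function.update_of_ne hxy, h2 y ⟨hy, hxy⟩]

theorem KSat_iff {AP : Type} {L : MLogic AP} {K : KripkeTree AP} {φ : MSOL AP}
    (h : φ.IsSentence) (V1 : ℕ → Node) (V2 : ℕ → Set Node) :
    L.KSat K φ ↔ Sat L.dom K V1 V2 φ := by
  constructor
  · rintro ⟨W1, W2, hW⟩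
    exact (Sat_congr φ W1 V1 W2 V2 (by simp [h.1]) (by simp [h.2])).1 hW
  · exact fun hV => ⟨V1, V2, hV⟩

theorem Leq_trans {AP : Type} {M : Set (KripkeTree AP)} {L L' L'' : MLogic AP}
    (h : L.Leq M L') (h' : L'.Leq M L'') : L.Leq M L'' := by
  intro φ hφ hs
  obtain ⟨ψ, h1, h2, h3⟩ := h φ hφ hs
  obtain ⟨χ, k1, k2, k3⟩ := h' ψ h1 h2
  exact ⟨χ, k1, k2, fun K hK => (h3 K hK).trans (k3 K hK)⟩

theorem Leq_mono {AP : Type} {M M' : Set (KripkeTree AP)} {L L' : MLogic AP} (hM : M' ⊆ M)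
    (h : L.Leq M L') : L.Leq M' L' := by
  intro φ hφ hs
  obtain ⟨ψ, h1, h2, h3⟩ := h φ hφ hs
  exact ⟨ψ, h1, h2, fun K hK => h3 K (hM hK)⟩

/-! ### Relativization -/

def relat {AP : Type} (δ : ℕ → MSOL AP) : MSOL AP → MSOL AP
  | .atom a x => .atom a x
  | .le x y => .le x y
  | .mem x X => .mem x X
  | .not φ => .not (relat δ φ)
  | .and φ ψ => .and (relat δ φ) (relat δ ψ)
  | .exFO x φ => .exFO x (relat δ φ)
  | .exSO X φ => .exSO X (.and (δ X) (relat δ φ))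

theorem relat_sat {AP : Type} {D D' : SODom} {K : KripkeTree AP} {δ : ℕ → MSOL AP}
    (hsub : D K.T ⊆ D' K.T)
    (hδ : ∀ X V1 V2, V2 X ∈ D' K.T → (Sat D' K V1 V2 (δ X) ↔ V2 X ∈ D K.T)) (φ : MSOL AP) :
    ∀ V1 V2, Sat D K V1 V2 φ ↔ Sat D' K V1 V2 (relat δ φ) := by
  induction φ with
  | atom a x => intro V1 V2; rfl
  | le x y => intro V1 V2; rfl
  | mem x X => intro V1 V2; rfl
  | not φ ih => intro V1 V2; simp only [Sat, relat, ih]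
  | and φ ψ ih ih' => intro V1 V2; simp only [Sat, relat, ih, ih']
  | exFO x φ ih => intro V1 V2; simp only [Sat, relat, ih]
  | exSO X φ ih =>
    intro V1 V2; simp only [Sat, relat, ih]
    constructor
    · rintro ⟨S, hS, h⟩
      exact ⟨S, hsub hS, (hδ _ _ _ (by simpa using hsub hS)).2 (by simpa using hS), h⟩
    · rintro ⟨S, hS, h, h'⟩
      exact ⟨S, by simpa using (hδ _ _ _ (by simpa using hS)).1 h, h'⟩

theorem relat_free {AP : Type} {δ : ℕ → MSOL AP} (h1 : ∀ X, (δ X).freeFO = ∅)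
    (h2 : ∀ X, (δ X).freeSO ⊆ {X}) (φ : MSOL AP) :
    (relat δ φ).freeFO = φ.freeFO ∧ (relat δ φ).freeSO = φ.freeSO := by
  induction φ with
  | atom a x => exact ⟨rfl, rfl⟩
  | le x y => exact ⟨rfl, rfl⟩
  | mem x X => exact ⟨rfl, rfl⟩
  | not φ ih => exact ih
  | and φ ψ ih ih' => simp [relat, MSOL.freeFO, MSOL.freeSO, ih, ih']
  | exFO x φ ih => simp [relat, MSOL.freeFO, MSOL.freeSO, ih]
  | exSO X φ ih =>
    simp only [relat, MSOL.freeFO, MSOL.freeSO, ih, h1, Set.empty_union, true_and]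
    ext Y
    have := @h2 X Y
    simp only [Set.mem_singleton_iff] at this
    simp only [Set.mem_sdiff, Set.mem_union, Set.mem_singleton_iff]
    tauto

theorem Leq_of_relat {AP : Type} {M : Set (KripkeTree AP)} {D D' : SODom} (δ : ℕ → MSOL AP)
    (h1 : ∀ X, (δ X).freeFO = ∅) (h2 : ∀ X, (δ X).freeSO ⊆ {X})
    (hsub : ∀ K ∈ M, D K.T ⊆ D' K.T)
    (hδ : ∀ K ∈ M, ∀ X V1 V2, V2 X ∈ D' K.T → (Sat D' K V1 V2 (δ X) ↔ V2 X ∈ D K.T)) :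
    MLogic.Leq M ⟨fun _ => True, D⟩ ⟨fun _ => True, D'⟩ := by
  intro φ hφ _
  refine ⟨relat δ φ, ?_, trivial, ?_⟩
  · obtain ⟨e1, e2⟩ := relat_free h1 h2 φ
    exact ⟨e1.trans hφ.1, e2.trans hφ.2⟩
  · intro K hK
    exact exists_congr fun V1 => exists_congr fun V2 => relat_sat (hsub K hK) (hδ K hK) φ V1 V2

theorem tree_down {T : Set Node} {r : Node} (h : IsTreeRooted T r) {x y : Node} (hx : x ∈ T)
    (hry : r <+: y) (hyx : y <+: x) : y ∈ T := by
  obtain ⟨s, rfl⟩ := h.2.1 x hx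
  obtain ⟨t, rfl⟩ := hry
  exact h.2.2 s t hx ((List.prefix_append_right_inj r).1 hyx)

theorem tree_iff {T : Set Node} {r : Node} : IsTreeRooted T r ↔
    r ∈ T ∧ (∀ x ∈ T, r <+: x) ∧ ∀ x ∈ T, ∀ y, r <+: y → y <+: x → y ∈ T := by
  constructor
  · exact fun h => ⟨h.1, h.2.1, fun x hx y h1 h2 => tree_down h hx h1 h2⟩
  · rintro ⟨h1, h2, h3⟩
    exact ⟨h1, h2, fun s s' hs hss => h3 _ hs _ (List.prefix_append _ _)
      ((List.prefix_append_right_inj r).2 hss)⟩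

/-- `X` is a tree -/
def dTree {AP : Type} (X : ℕ) : MSOL AP :=
  .exFO 0 (.and (.mem 0 X) (.and
    (.not (.exFO 1 (.and (.mem 1 X) (.not (.le 0 1)))))
    (.not (.exFO 1 (.and (.mem 1 X) (.exFO 2 (.and (.le 0 2) (.and (.le 2 1) (.not (.mem 2 X))))))))))

theorem dTree_sat {AP : Type} {D : SODom} {K : KripkeTree AP} (X : ℕ) (V1 : ℕ → Node)
    (V2 : ℕ → Set Node) (h : V2 X ⊆ K.T) : Sat D K V1 V2 (dTree X) ↔ IsTree (V2 X) := by
  simp only [dTree, Sat, IsTree, tree_iff, Function.update_self, ne_eq, reduceCtorEq, not_false_eq_true,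
    Function.update_of_ne, OfNat.ofNat_ne_zero, zero_ne_one, OfNat.zero_ne_ofNat, one_ne_zero,
    OfNat.ofNat_ne_one, OfNat.one_ne_ofNat]
  constructor
  · rintro ⟨r, hr, h1, h2, h3⟩
    push Not at h2 h3
    refine ⟨r, h1, fun x hx => (h2 x (h hx) hx).2.2, fun x hx y hy hyx => ?_⟩
    have hy' := tree_down K.rooted (h hx) ((K.rooted.2.1 r hr).trans hy) hyx
    exact h3 x (h hx) hx y hy' ⟨hr, hy', hy⟩ ⟨hy', h hx, hyx⟩
  · rintro ⟨r, h1, h2, h3⟩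
    push Not
    refine ⟨r, h h1, h1, fun x hx hxx => ⟨h h1, hx, h2 x hxx⟩, ?_⟩
    intro x hx hxx y hy hry hyx
    exact h3 x hxx y hry.2.2 hyx.2.2

theorem MTL_le_MSO {AP : Type} (M : Set (KripkeTree AP)) : MLogic.Leq M (MTL AP) (MSO AP) := by
  refine Leq_of_relat dTree ?_ ?_ (fun K _ S hS => hS.1) ?_
  · intro X; ext y; simp [dTree, MSOL.freeFO]; grind
  · intro X; simp [dTree, MSOL.freeSO]
  · intro K _ X V1 V2 h
    rw [dTree_sat X V1 V2 h]
    exact ⟨fun h' => ⟨h, h'⟩, fun h => h.2⟩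

theorem WMTL_le_WMSO {AP : Type} (M : Set (KripkeTree AP)) :
    MLogic.Leq M (WMTL AP) (WMSO AP) := by
  refine Leq_of_relat dTree ?_ ?_ (fun K _ S hS => ⟨hS.1.1, hS.2⟩) ?_
  · intro X; ext y; simp [dTree, MSOL.freeFO]; grind
  · intro X; simp [dTree, MSOL.freeSO]
  · intro K _ X V1 V2 h
    rw [dTree_sat X V1 V2 h.1]
    exact ⟨fun h' => ⟨⟨h.1, h'⟩, h.2⟩, fun h => h.1.2⟩

/-! ### infinity over finitely branching trees -/

/-- `X` has a nonblocking subtree -/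
def dInf {AP : Type} (X : ℕ) : MSOL AP :=
  .exSO (X+1) (.and (.not (.exFO 0 (.and (.mem 0 (X+1)) (.not (.mem 0 X)))))
    (.not (.exFO 0 (.and (.mem 0 (X+1)) (.not (.exFO 1 (.and (.mem 1 (X+1))
      (.and (.le 0 1) (.not (.le 1 0))))))))))

theorem prefix_eq {a b : Node} (h : a <+: b) (h' : b <+: a) : a = b :=
  h.eq_of_length (le_antisymm h.length_le h'.length_le)

theorem konig {T S : Set Node} (hf : FinBranching T) (hS : S ⊆ T) (hT : IsTree S) :
    S.Infinite ↔ ∃ Y, IsTree Y ∧ Y ⊆ S ∧ ∀ x ∈ Y, ∃ y ∈ Y, x <+: y ∧ ¬ y <+: x := by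
  constructor
  · intro hinf
    obtain ⟨r, hr⟩ := hT
    have hr' := tree_iff.1 hr
    refine ⟨{x | x ∈ S ∧ {y | y ∈ S ∧ x <+: y}.Infinite}, ⟨r, tree_iff.2 ⟨⟨hr.1, ?_⟩, ?_, ?_⟩⟩,
      fun x hx => hx.1, ?_⟩
    · refine hinf.mono fun y hy => ⟨hy, hr.2.1 y hy⟩
    · exact fun x hx => hr.2.1 x hx.1
    · intro x hx y hy hyx
      exact ⟨hr'.2.2 x hx.1 y hy hyx, hx.2.mono fun z hz => ⟨hz.1, hyx.trans hz.2⟩⟩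
    · rintro x ⟨hx, hxi⟩
      by_contra hcon
      push Not at hcon
      apply hxi
      have hfin : ({x} ∪ ⋃ c ∈ {c | childIn T x c ∧ c ∈ S}, {y | y ∈ S ∧ c <+: y}).Finite := by
        refine (Set.finite_singleton x).union (Set.Finite.biUnion ?_ ?_)
        · exact (hf x (hS hx)).subset fun c hc => hc.1
        · rintro c ⟨⟨hc, n, rfl⟩, hcS⟩
          by_contra hc'
          have := hcon (x ++ [n]) ⟨hcS, hc'⟩ (List.prefix_append _ _)
          have := this.length_le
          simp at this
      refine hfin.subset ?_
      rintro y ⟨hy, t, rfl⟩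
      rcases t with _ | ⟨n, t⟩
      · simp
      · right
        have hp : x ++ [n] <+: x ++ n :: t := ⟨t, by simp⟩
        have hc : x ++ [n] ∈ S := hr'.2.2 _ hy _ ((hr.2.1 x hx).trans (List.prefix_append _ _)) hp
        exact Set.mem_biUnion (x := x ++ [n]) ⟨⟨hS hc, n, rfl⟩, hc⟩ ⟨hy, hp⟩
  · rintro ⟨Y, ⟨r, hr⟩, hYS, hY⟩ hfin
    obtain ⟨x, hx, hmax⟩ := Set.exists_max_image Y List.length (hfin.subset hYS) ⟨r, hr.1⟩
    obtain ⟨y, hy, h1, h2⟩ := hY x hx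
    have := h1.eq_of_length (le_antisymm h1.length_le (hmax y hy))
    subst this
    exact h2 h1

theorem CoWMTL_le_MTL (AP : Type) : MLogic.Leq (finBrKT AP) (CoWMTL AP) (MTL AP) := by
  refine Leq_of_relat dInf ?_ ?_ (fun K _ S hS => hS.1) ?_
  · intro X; ext y; simp [dInf, MSOL.freeFO]
  · intro X; simp [dInf, MSOL.freeSO]
  · intro K hK X V1 V2 h
    have : V2 X ∈ coweakDom MTLdom K.T ↔ (V2 X).Infinite := ⟨fun h => h.2, fun h' => ⟨h, h'⟩⟩
    rw [this, konig hK h.1 h.2]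
    simp only [dInf, Sat, Function.update_self, ne_eq, not_false_eq_true,
      Function.update_of_ne, zero_ne_one, one_ne_zero, Nat.left_eq_add]
    constructor
    · rintro ⟨Y, hY, h1, h2⟩
      push Not at h1 h2
      refine ⟨Y, hY.2, fun x hx => h1 x (hY.1 hx) hx, fun x hx => ?_⟩
      obtain ⟨y, hy, hy', hxy, hyx⟩ := h2 x (hY.1 hx) hx
      exact ⟨y, hy', hxy.2.2, hyx hy (hY.1 hx)⟩
    · rintro ⟨Y, hY, h1, h2⟩
      have hYT := h1.trans h.1
      refine ⟨Y, ⟨hYT, hY⟩, ?_, ?_⟩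
      · rintro ⟨x, hx, hx', hh⟩; exact hh (h1 hx')
      · rintro ⟨x, hx, hx', hh⟩
        obtain ⟨y, hy, hxy, hyx⟩ := h2 x hx'
        exact hh ⟨y, hYT hy, hy, ⟨hx, hYT hy, hxy⟩, fun h => hyx h.2.2⟩

set_option linter.unusedSimpArgs false

/-! ### MTL and WMTL inside CoWMTL -/

def decS (T X : Set Node) (l m : Node) : Set Node :=
  {y | y ∈ X ∧ ¬ (l ∈ T ∧ l = m ∧ y ∈ T ∧ l <+: y ∧ ¬ y <+: l)}

def memE {AP : Type} (y X : ℕ) : MSOL AP :=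
  .and (.mem (3*y) X) (.not (.and (.and (.le (3*X+1) (3*X+2)) (.le (3*X+2) (3*X+1)))
    (.and (.le (3*X+1) (3*y)) (.not (.le (3*y) (3*X+1))))))

def trE {AP : Type} (δ : ℕ → MSOL AP) : MSOL AP → MSOL AP
  | .atom a x => .atom a (3*x)
  | .le x y => .le (3*x) (3*y)
  | .mem x X => memE x X
  | .not φ => .not (trE δ φ)
  | .and φ ψ => .and (trE δ φ) (trE δ ψ)
  | .exFO x φ => .exFO (3*x) (trE δ φ)
  | .exSO X φ => .exSO X (.exFO (3*X+1) (.exFO (3*X+2)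
      (.and (.mem (3*X+1) X) (.and (δ X) (trE δ φ)))))

theorem memE_sat {AP : Type} {D : SODom} {K : KripkeTree AP} (V1 : ℕ → Node)
    (V2 : ℕ → Set Node) (y X : ℕ) : Sat D K V1 V2 (memE y X) ↔
      V1 (3*y) ∈ decS K.T (V2 X) (V1 (3*X+1)) (V1 (3*X+2)) := by
  simp only [memE, Sat, decS, Set.mem_ofPred_eq]
  refine and_congr_right fun _ => not_congr ?_
  constructor
  · rintro ⟨⟨h1, h2⟩, h3, h4⟩
    exact ⟨h1.1, prefix_eq h1.2.2 h2.2.2, h3.2.1, h3.2.2, fun h => h4 ⟨h3.2.1, h1.1, h⟩⟩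
  · rintro ⟨h1, h2, h3, h4, h5⟩
    rw [← h2]
    exact ⟨⟨⟨h1, h1, List.prefix_rfl⟩, ⟨h1, h1, List.prefix_rfl⟩⟩, ⟨h1, h3, h4⟩, fun h => h5 h.2.2⟩

theorem trE_sat {AP : Type} {D D' : SODom} {K : KripkeTree AP} {δ : ℕ → MSOL AP}
    (P : Set Node → Prop)
    (hδ : ∀ X V1 V2, V2 X ∈ D' K.T → V1 (3*X+1) ∈ V2 X → (Sat D' K V1 V2 (δ X) ↔
      P (decS K.T (V2 X) (V1 (3*X+1)) (V1 (3*X+2)))))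
    (hD : ∀ S, S ∈ D K.T ↔ ∃ X ∈ D' K.T, ∃ l ∈ K.T, ∃ m ∈ K.T, l ∈ X ∧
      P (decS K.T X l m) ∧ decS K.T X l m = S) (φ : MSOL AP) :
    ∀ V1 V2, Sat D K (fun x => V1 (3*x)) (fun X => decS K.T (V2 X) (V1 (3*X+1)) (V1 (3*X+2))) φ ↔
      Sat D' K V1 V2 (trE δ φ) := by
  induction φ with
  | atom a x => intro V1 V2; rfl
  | le x y => intro V1 V2; rfl
  | mem x X => intro V1 V2; simp only [trE, memE_sat]; rfl
  | not φ ih => intro V1 V2; simp only [Sat, trE, ih]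
  | and φ ψ ih ih' => intro V1 V2; simp only [Sat, trE, ih, ih']
  | exFO x φ ih =>
    intro V1 V2; simp only [Sat, trE, ← ih]
    refine exists_congr fun τ => and_congr_right fun _ => ?_
    have e1 : Function.update (fun x => V1 (3*x)) x τ =
        fun y => Function.update V1 (3*x) τ (3*y) := by
      funext y; simp [Function.update_apply]
    have e2 : ∀ X, Function.update V1 (3*x) τ (3*X+1) = V1 (3*X+1) :=
      fun X => Function.update_of_ne (by omega) _ _
    have e3 : ∀ X, Function.update V1 (3*x) τ (3*X+2) = V1 (3*X+2) :=
      fun X => Function.update_of_ne (by omega) _ _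
    rw [e1]; simp only [e2, e3]
  | exSO X φ ih =>
    intro V1 V2; simp only [Sat, trE, ← ih]
    have key : ∀ X0 l m, (fun x => Function.update (Function.update V1 (3*X+1) l) (3*X+2) m (3*x)) =
          (fun x => V1 (3*x)) ∧
        (fun Y => decS K.T (Function.update V2 X X0 Y)
          (Function.update (Function.update V1 (3*X+1) l) (3*X+2) m (3*Y+1))
          (Function.update (Function.update V1 (3*X+1) l) (3*X+2) m (3*Y+2))) =
        Function.update (fun X => decS K.T (V2 X) (V1 (3*X+1)) (V1 (3*X+2))) X
          (decS K.T X0 l m) := by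
      intro X0 l m
      constructor
      · funext y
        rw [Function.update_of_ne (by omega), Function.update_of_ne (by omega)]
      · funext Y
        by_cases hY : Y = X
        · subst hY; simp
        · simp only [Function.update_of_ne hY]
          rw [Function.update_of_ne (by omega), Function.update_of_ne (by omega),
            Function.update_of_ne (by omega), Function.update_of_ne (by omega)]
    have eA : ∀ l m, Function.update (Function.update V1 (3*X+1) l) (3*X+2) m (3*X+1) = l := by
      intro l m; rw [Function.update_of_ne (by omega)]; simp
    constructor
    · rintro ⟨S, hS, h⟩
      obtain ⟨X0, hX0, l, hl, m, hm, hlX, hP, rfl⟩ := (hD S).1 hS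
      refine ⟨X0, hX0, l, hl, m, hm, by rw [eA]; simpa using hlX, ?_, ?_⟩
      · rw [hδ]
        · rw [eA]; simpa using hP
        · simpa using hX0
        · rw [eA]; simpa using hlX
      · rw [(key X0 l m).1, (key X0 l m).2]; exact h
    · rintro ⟨X0, hX0, l, hl, m, hm, hlX, hd, h⟩
      rw [(key X0 l m).1, (key X0 l m).2] at h
      rw [hδ _ _ _ (by simpa using hX0) hlX, eA] at hd
      rw [eA] at hlX
      simp only [Function.update_self] at hd hlX
      exact ⟨_, (hD _).2 ⟨X0, hX0, l, hl, m, hm, hlX, hd, rfl⟩, h⟩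

theorem trE_free {AP : Type} {δ : ℕ → MSOL AP} (h1 : ∀ X, (δ X).freeFO ⊆ {3*X+1, 3*X+2})
    (h2 : ∀ X, (δ X).freeSO ⊆ {X}) (φ : MSOL AP) :
    (∀ y ∈ (trE δ φ).freeFO, (∃ x ∈ φ.freeFO, y = 3*x) ∨
      (∃ X ∈ φ.freeSO, y = 3*X+1 ∨ y = 3*X+2)) ∧ (trE δ φ).freeSO ⊆ φ.freeSO := by
  induction φ with
  | atom a x => simp [trE, MSOL.freeFO, MSOL.freeSO]
  | le x y => simp [trE, MSOL.freeFO, MSOL.freeSO]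
  | mem x X => simp [trE, memE, MSOL.freeFO, MSOL.freeSO]
  | not φ ih => exact ih
  | and φ ψ ih ih' =>
    simp only [trE, MSOL.freeFO, MSOL.freeSO]
    refine ⟨?_, Set.union_subset_union ih.2 ih'.2⟩
    rintro y (hy | hy)
    · rcases ih.1 y hy with ⟨x, hx, h⟩ | ⟨x, hx, h⟩
      · exact Or.inl ⟨x, Or.inl hx, h⟩
      · exact Or.inr ⟨x, Or.inl hx, h⟩
    · rcases ih'.1 y hy with ⟨x, hx, h⟩ | ⟨x, hx, h⟩
      · exact Or.inl ⟨x, Or.inr hx, h⟩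
      · exact Or.inr ⟨x, Or.inr hx, h⟩
  | exFO x φ ih =>
    simp only [trE, MSOL.freeFO, MSOL.freeSO]
    refine ⟨?_, ih.2⟩
    rintro y ⟨hy, hyx⟩
    rcases ih.1 y hy with ⟨x', hx, rfl⟩ | ⟨x', hx, h⟩
    · exact Or.inl ⟨x', ⟨hx, by rintro rfl; exact hyx rfl⟩, rfl⟩
    · exact Or.inr ⟨x', hx, h⟩
  | exSO X φ ih =>
    simp only [trE, MSOL.freeFO, MSOL.freeSO]
    constructor
    · rintro y ⟨⟨hy, hy1⟩, hy2⟩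
      simp only [Set.mem_singleton_iff] at hy1 hy2
      rcases hy with hy | hy | hy
      · exact absurd hy hy2
      · have := h1 X hy
        simp only [Set.mem_insert_iff, Set.mem_singleton_iff] at this
        tauto
      · rcases ih.1 y hy with ⟨x', hx, rfl⟩ | ⟨x', hx, h⟩
        · exact Or.inl ⟨x', hx, rfl⟩
        · refine Or.inr ⟨x', ⟨hx, ?_⟩, h⟩
          rintro rfl
          tauto
    · rintro Y ⟨hY | hY | hY, hYX⟩
      · exact absurd hY hYX
      · exact absurd (h2 X hY) hYX
      · exact ⟨ih.2 hY, hYX⟩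

theorem Leq_of_trE {AP : Type} {M : Set (KripkeTree AP)} {D D' : SODom} (δ : ℕ → MSOL AP)
    (P : Set Node → Prop)
    (h1 : ∀ X, (δ X).freeFO ⊆ {3*X+1, 3*X+2}) (h2 : ∀ X, (δ X).freeSO ⊆ {X})
    (hδ : ∀ K ∈ M, ∀ X V1 V2, V2 X ∈ D' K.T → V1 (3*X+1) ∈ V2 X → (Sat D' K V1 V2 (δ X) ↔
      P (decS K.T (V2 X) (V1 (3*X+1)) (V1 (3*X+2)))))
    (hD : ∀ K ∈ M, ∀ S, S ∈ D K.T ↔ ∃ X ∈ D' K.T, ∃ l ∈ K.T, ∃ m ∈ K.T, l ∈ X ∧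
      P (decS K.T X l m) ∧ decS K.T X l m = S) :
    MLogic.Leq M ⟨fun _ => True, D⟩ ⟨fun _ => True, D'⟩ := by
  intro φ hφ _
  have hs : (trE δ φ).IsSentence := by
    obtain ⟨e1, e2⟩ := trE_free h1 h2 φ
    rw [hφ.1, hφ.2] at e1
    rw [hφ.2] at e2
    refine ⟨?_, Set.subset_empty_iff.1 e2⟩
    ext y
    simp only [Set.mem_empty_iff_false, iff_false]
    intro hy
    simpa using e1 y hy
  refine ⟨trE δ φ, hs, trivial, ?_⟩
  intro K hK
  rw [KSat_iff hs (fun _ => []) (fun _ => ∅)]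
  rw [← trE_sat P (hδ K hK) (hD K hK) φ]
  exact KSat_iff hφ _ _

theorem decS_tree {T X : Set Node} {l m : Node} (hXT : X ⊆ T) (hX : IsTree X) (hl : l ∈ X) :
    IsTree (decS T X l m) := by
  obtain ⟨r, hr⟩ := hX
  have hr' := tree_iff.1 hr
  refine ⟨r, tree_iff.2 ⟨⟨hr.1, fun h => h.2.2.2.2 (hr.2.1 l hl)⟩, fun x hx => hr.2.1 x hx.1, ?_⟩⟩
  intro x hx y hry hyx
  refine ⟨hr'.2.2 x hx.1 y hry hyx, ?_⟩
  rintro ⟨h1, h2, h3, h4, h5⟩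
  exact hx.2 ⟨h1, h2, hXT hx.1, h4.trans hyx, fun h => h5 (hyx.trans h)⟩

theorem cone_infinite {AP : Type} (K : KripkeTree AP) {l : Node} (hl : l ∈ K.T) :
    {y | y ∈ K.T ∧ l <+: y}.Infinite := by
  intro hf
  obtain ⟨x, hx, hmax⟩ := Set.exists_max_image _ List.length hf ⟨l, hl, List.prefix_rfl⟩
  obtain ⟨n, hn⟩ := K.nonblocking x hx.1
  have := hmax (x ++ [n]) ⟨hn, hx.2.trans (List.prefix_append _ _)⟩
  simp at this

theorem T_isTree {AP : Type} (K : KripkeTree AP) : IsTree K.T := ⟨_, K.rooted⟩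

theorem T_infinite {AP : Type} (K : KripkeTree AP) : K.T.Infinite :=
  (cone_infinite K K.rooted.1).mono fun _ h => h.1

theorem fin_code {AP : Type} (K : KripkeTree AP) {S : Set Node} (hS : S ⊆ K.T) (hT : IsTree S)
    (hf : S.Finite) : ∃ X ∈ coweakDom MTLdom K.T, ∃ l ∈ K.T, l ∈ X ∧ decS K.T X l l = S := by
  obtain ⟨r, hr⟩ := hT
  have hr' := tree_iff.1 hr
  obtain ⟨l, hl, hmax⟩ := Set.exists_max_image S List.length hf ⟨r, hr.1⟩
  refine ⟨S ∪ {y | y ∈ K.T ∧ l <+: y}, ⟨⟨?_, r, tree_iff.2 ⟨Or.inl hr.1, ?_, ?_⟩⟩, ?_⟩, l, hS hl,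
    Or.inl hl, ?_⟩
  · exact Set.union_subset hS fun y hy => hy.1
  · rintro x (hx | hx)
    · exact hr.2.1 x hx
    · exact (hr.2.1 l hl).trans hx.2
  · rintro x (hx | hx) y hry hyx
    · exact Or.inl (hr'.2.2 x hx y hry hyx)
    · rcases List.prefix_or_prefix_of_prefix hyx hx.2 with h | h
      · exact Or.inl (hr'.2.2 l hl y hry h)
      · exact Or.inr ⟨tree_down K.rooted hx.1 ((K.rooted.2.1 _ (hS hr.1)).trans hry) hyx, h⟩
  · exact (cone_infinite K (hS hl)).mono fun y hy => Or.inr hy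
  · ext y
    constructor
    · rintro ⟨hy | hy, h⟩
      · exact hy
      · have : y <+: l := by
          by_contra hc
          exact h ⟨hS hl, rfl, hy.1, hy.2, hc⟩
        rw [prefix_eq this hy.2]; exact hl
    · intro hy
      refine ⟨Or.inl hy, ?_⟩
      rintro ⟨_, _, _, h1, h2⟩
      exact h2 ((h1.eq_of_length (le_antisymm h1.length_le (hmax y hy))) ▸ List.prefix_rfl)

theorem MTL_le_CoWMTL {AP : Type} (M : Set (KripkeTree AP)) :
    MLogic.Leq M (MTL AP) (CoWMTL AP) := by
  refine Leq_of_trE (fun X => .mem (3*X+1) X) (fun _ => True) ?_ ?_ ?_ ?_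
  · intro X; simp [MSOL.freeFO]
  · intro X; simp [MSOL.freeSO]
  · intro K _ X V1 V2 _ h; simpa [Sat] using h
  · intro K _ S
    constructor
    · rintro ⟨hS, hT⟩
      by_cases hf : S.Finite
      · obtain ⟨X, hX, l, hl, hlX, h⟩ := fin_code K hS hT hf
        exact ⟨X, hX, l, hl, l, hl, hlX, trivial, h⟩
      · obtain ⟨r, hr⟩ := hT
        obtain ⟨n, hn⟩ := K.nonblocking r (hS hr.1)
        refine ⟨S, ⟨⟨hS, r, hr⟩, hf⟩, r, hS hr.1, r ++ [n], hn, hr.1, trivial, ?_⟩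
        ext y
        simp [decS]
    · rintro ⟨X, hX, l, hl, m, hm, hlX, -, rfl⟩
      exact ⟨fun y hy => hX.1.1 hy.1, decS_tree hX.1.1 hX.1.2 hlX⟩

def dFin {AP : Type} (X : ℕ) : MSOL AP :=
  .not (.exSO (X+1) (.not (.exFO (3*0) (.and (.mem (3*0) (X+1)) (.not (memE 0 X))))))

theorem WMTL_le_CoWMTL {AP : Type} (M : Set (KripkeTree AP)) :
    MLogic.Leq M (WMTL AP) (CoWMTL AP) := by
  refine Leq_of_trE dFin (fun S => S.Finite) ?_ ?_ ?_ ?_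
  · intro X y; simp [dFin, memE, MSOL.freeFO]; omega
  · intro X y; simp [dFin, memE, MSOL.freeSO]
  · intro K _ X V1 V2 hX hl
    have e1 : ∀ τ : Node, Function.update V1 (3*0) τ (3*X+1) = V1 (3*X+1) :=
      fun τ => Function.update_of_ne (by omega) _ _
    have e2 : ∀ τ : Node, Function.update V1 (3*0) τ (3*X+2) = V1 (3*X+2) :=
      fun τ => Function.update_of_ne (by omega) _ _
    simp only [dFin, Sat, memE_sat, e1, e2, Function.update_self, ne_eq, Nat.left_eq_add, one_ne_zero,
      not_false_eq_true, Function.update_of_ne]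
    constructor
    · intro h
      by_contra hi
      apply h
      refine ⟨_, ⟨⟨fun y hy => hX.1.1 hy.1, decS_tree hX.1.1 hX.1.2 hl⟩, hi⟩, ?_⟩
      rintro ⟨τ, _, h1, h2⟩
      exact h2 h1
    · rintro h ⟨Y, hY, h'⟩
      push Not at h'
      exact hY.2 (h.subset fun y hy => h' y (hY.1.1 hy) hy)
  · intro K _ S
    constructor
    · rintro ⟨⟨hS, hT⟩, hf⟩
      obtain ⟨X, hX, l, hl, hlX, h⟩ := fin_code K hS hT hf
      exact ⟨X, hX, l, hl, l, hl, hlX, h ▸ hf, h⟩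
    · rintro ⟨X, hX, l, hl, m, hm, hlX, hf, rfl⟩
      exact ⟨⟨fun y hy => hX.1.1 hy.1, decS_tree hX.1.1 hX.1.2 hlX⟩, hf⟩

set_option linter.unusedSimpArgs false

/-! ### CoWMTL is not inside WMSO: a Borel argument -/

namespace BorelPart

def pre (x : ℕ → ℕ) (n : ℕ) : List ℕ := (List.range n).map x

theorem pre_succ (x : ℕ → ℕ) (n : ℕ) : pre x (n+1) = pre x n ++ [x n] := by
  simp [pre, List.range_succ]

@[simp] theorem pre_length (x : ℕ → ℕ) (n : ℕ) : (pre x n).length = n := by simp [pre]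

theorem pre_prefix (x : ℕ → ℕ) {m n : ℕ} (h : m ≤ n) : pre x m <+: pre x n := by
  induction h with
  | refl => exact List.prefix_rfl
  | step _ ih => rw [pre_succ]; exact ih.trans (List.prefix_append _ _)

theorem eq_pre_of_prefix {x : ℕ → ℕ} {n : ℕ} {s : List ℕ} (h : s <+: pre x n) :
    s = pre x s.length := by
  have h1 : s.length ≤ n := by simpa using h.length_le
  have h2 := pre_prefix x h1
  rcases List.prefix_or_prefix_of_prefix h h2 with h3 | h3
  · exact h3.eq_of_length (by simp)
  · exact (h3.eq_of_length (by simp)).symm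

theorem pre_inj {x y : ℕ → ℕ} {n i : ℕ} (h : pre x n = pre y n) (hi : i < n) : x i = y i := by
  have := congrArg (fun l => l.getD i 0) h
  simpa [pre, hi] using this

def U (x : ℕ → ℕ) : Set (List ℕ) :=
  {s | ∀ s', s' <+: s → s' ≠ [] → x (Encodable.encode (s', pre x s'.length)) ≠ 0}

def ill (x : ℕ → ℕ) : Prop := ∃ y, ∀ n, pre y n ∈ U x

theorem U_down {x : ℕ → ℕ} {s t : List ℕ} (h : t ∈ U x) (hst : s <+: t) : s ∈ U x :=
  fun s' hs' => h s' (hs'.trans hst)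

theorem measurable_pre (n : ℕ) (t : List ℕ) : MeasurableSet {x : ℕ → ℕ | pre x n = t} := by
  have : {x : ℕ → ℕ | pre x n = t} =
      {x : ℕ → ℕ | t.length = n} ∩ ⋂ i : ℕ, {x : ℕ → ℕ | i < n → x i = t.getD i 0} := by
    ext x
    simp only [Set.mem_ofPred_eq, Set.mem_inter_iff, Set.mem_iInter]
    constructor
    · rintro rfl
      exact ⟨by simp, fun i hi => by simp [pre, hi]⟩
    · rintro ⟨h1, h2⟩
      apply List.ext_getElem
      · simp [h1]
      · intro i hi hi'
        have := h2 i (by simpa using hi)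
        simp [pre, this, hi']
  rw [this]
  refine (MeasurableSet.const _).inter (MeasurableSet.iInter fun i => ?_)
  by_cases hi : i < n
  · simp only [hi, true_imp_iff]
    exact measurableSet_eq_fun (measurable_pi_apply i) measurable_const
  · simp [hi]

theorem measurable_U (s : List ℕ) : MeasurableSet {x : ℕ → ℕ | s ∈ U x} := by
  have : {x : ℕ → ℕ | s ∈ U x} = ⋂ s' : List ℕ, {x | s' <+: s → s' ≠ [] →
      x ∈ ⋃ t : List ℕ, ({x | pre x s'.length = t} ∩ {x | x (Encodable.encode (s', t)) = 0}ᶜ)} := by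
    ext x
    simp [U]
  rw [this]
  refine MeasurableSet.iInter fun s' => ?_
  by_cases h : s' <+: s
  · by_cases h' : s' = []
    · simp [h']
    · simp only [h, true_imp_iff, ne_eq, h', not_false_eq_true]
      refine MeasurableSet.iUnion fun t => (measurable_pre _ _).inter (MeasurableSet.compl ?_)
      exact measurableSet_eq_fun (measurable_pi_apply _) measurable_const
  · simp [h]

open Filter Topology in
theorem not_measurable : ¬ MeasurableSet {x | ill x} := by
  intro hm
  have hA : MeasureTheory.AnalyticSet {x | ill x}ᶜ := hm.compl.analyticSet
  rw [MeasureTheory.AnalyticSet] at hA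
  rcases hA with h | ⟨f, hf, hr⟩
  · have h0 : (fun _ => 0 : ℕ → ℕ) ∈ {x | ill x} := by
      have : (fun _ => 0 : ℕ → ℕ) ∉ {x | ill x}ᶜ := by rw [h]; simp
      simpa using this
    obtain ⟨y, hy⟩ := h0
    exact hy 1 (pre y 1) List.prefix_rfl (by simp [pre]) rfl
  · classical
    let c : ℕ → ℕ := fun k => match (Encodable.decode k : Option (List ℕ × List ℕ)) with
      | some (s, t) => if ∃ y, pre y s.length = s ∧ pre (f y) t.length = t then 1 else 0
      | none => 0
    have hc : ∀ s t, c (Encodable.encode (s, t)) ≠ 0 ↔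
        ∃ y, pre y s.length = s ∧ pre (f y) t.length = t := by
      intro s t
      simp only [c, Encodable.encodek]
      split_ifs with h <;> simp [h]
    have key : ill c ↔ c ∈ Set.range f := by
      constructor
      · rintro ⟨y, hy⟩
        have : ∀ n, ∃ y', pre y' (n+1) = pre y (n+1) ∧ pre (f y') (n+1) = pre c (n+1) := by
          intro n
          have := hy (n+1) (pre y (n+1)) List.prefix_rfl (by simp [pre_succ])
          rw [hc] at this
          simpa using this
        choose y' h1 h2 using this
        have t1 : Tendsto y' atTop (𝓝 y) := by
          rw [tendsto_pi_nhds]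
          intro i
          refine tendsto_const_nhds.congr' ?_
          filter_upwards [eventually_ge_atTop i] with n hn
          exact (pre_inj (h1 n) (by omega)).symm
        have t2 : Tendsto (fun n => f (y' n)) atTop (𝓝 c) := by
          rw [tendsto_pi_nhds]
          intro i
          refine tendsto_const_nhds.congr' ?_
          filter_upwards [eventually_ge_atTop i] with n hn
          exact (pre_inj (h2 n) (by omega)).symm
        exact ⟨y, tendsto_nhds_unique ((hf.tendsto y).comp t1) t2⟩
      · rintro ⟨y, hy⟩
        refine ⟨y, fun n s hs _ => ?_⟩
        rw [hc]
        refine ⟨y, (eq_pre_of_prefix hs).symm, by rw [hy]; simp⟩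
    rw [hr] at key
    simp at key

/-! decoding of words -/

def step (p : List ℕ × ℕ) (a : ℕ) : List ℕ × ℕ :=
  if a = 0 then (p.1, p.2 + 1) else (p.1 ++ [p.2], 0)

def dec (w : List ℕ) : List ℕ × ℕ := w.foldl step ([], 0)

theorem dec_snoc (w : List ℕ) (a : ℕ) : dec (w ++ [a]) = step (dec w) a := by
  simp [dec]

theorem dec_mono (w v : List ℕ) : (dec w).1 <+: (dec (w ++ v)).1 := by
  induction v using List.reverseRecOn with
  | nil => simp
  | append_singleton v a ih =>
    rw [← List.append_assoc, dec_snoc, step]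
    split_ifs
    · exact ih
    · exact ih.trans (List.prefix_append _ _)

theorem dec_length (w : List ℕ) : (dec w).1.length = w.countP (· ≠ 0) := by
  induction w using List.reverseRecOn with
  | nil => simp [dec]
  | append_singleton v a ih =>
    rw [dec_snoc, step, List.countP_append, ← ih]
    split_ifs with h <;> simp [h]

def Tx (x : ℕ → ℕ) : Set Node := {w | (∀ a ∈ w, a ≤ 2) ∧ (dec w).1 ∈ U x}

def Kx (AP : Type) (x : ℕ → ℕ) : KripkeTree AP where
  T := Tx x
  root := []
  rooted := by
    rw [tree_iff]
    refine ⟨⟨by simp, ?_⟩, by simp, ?_⟩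
    · intro s hs hne
      have : s = [] := by simpa [dec] using hs
      exact absurd this hne
    · rintro w hw y - ⟨v, rfl⟩
      exact ⟨fun a ha => hw.1 a (by simp [ha]), U_down hw.2 (dec_mono _ _)⟩
  nonblocking := by
    intro w hw
    refine ⟨0, ?_, ?_⟩
    · intro a ha
      simp at ha
      rcases ha with h | h
      · exact hw.1 a h
      · omega
    · rw [dec_snoc]; simpa [step] using hw.2
  Lab := fun _ => ∅

theorem Kx_finBr (AP : Type) (x : ℕ → ℕ) : Kx AP x ∈ finBrKT AP := by
  intro τ _
  refine ((Set.finite_Iic 2).image (fun n => τ ++ [n])).subset ?_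
  rintro _ ⟨h, n, rfl⟩
  exact ⟨n, h.1 n (by simp), rfl⟩

theorem sat_measurable {AP : Type} (φ : MSOL AP) : ∀ V1 V2,
    MeasurableSet {x : ℕ → ℕ | Sat (weakDom MSOdom) (Kx AP x) V1 V2 φ} := by
  have hT : ∀ w : Node, MeasurableSet {x : ℕ → ℕ | w ∈ (Kx AP x).T} := by
    intro w
    exact (MeasurableSet.const (∀ a ∈ w, a ≤ 2)).inter (measurable_U _)
  induction φ with
  | atom a x => intro V1 V2; simp [Sat, Kx]
  | le x y =>
    intro V1 V2
    exact (hT _).inter ((hT _).inter (MeasurableSet.const (V1 x <+: V1 y)))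
  | mem x X => intro V1 V2; exact MeasurableSet.const (V1 x ∈ V2 X)
  | not φ ih => intro V1 V2; exact (ih V1 V2).compl
  | and φ ψ ih ih' => intro V1 V2; exact (ih V1 V2).inter (ih' V1 V2)
  | exFO x φ ih =>
    intro V1 V2
    have : {z : ℕ → ℕ | Sat (weakDom MSOdom) (Kx AP z) V1 V2 (.exFO x φ)} = ⋃ τ : Node,
        ({z | τ ∈ (Kx AP z).T} ∩ {z | Sat (weakDom MSOdom) (Kx AP z) (Function.update V1 x τ) V2 φ}) := by
      ext z; simp [Sat]
    rw [this]
    exact MeasurableSet.iUnion fun τ => (hT τ).inter (ih _ _)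
  | exSO X φ ih =>
    intro V1 V2
    have : {z : ℕ → ℕ | Sat (weakDom MSOdom) (Kx AP z) V1 V2 (.exSO X φ)} = ⋃ S : Finset Node,
        ((⋂ τ ∈ S, {z | τ ∈ (Kx AP z).T}) ∩
          {z | Sat (weakDom MSOdom) (Kx AP z) V1 (Function.update V2 X S) φ}) := by
      ext z
      simp only [Sat, Set.mem_ofPred_eq, Set.mem_iUnion, Set.mem_inter_iff, Set.mem_iInter]
      constructor
      · rintro ⟨S, ⟨hS, hf⟩, h⟩
        refine ⟨hf.toFinset, fun τ hτ => hS (by simpa using hτ), by simpa using h⟩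
      · rintro ⟨S, hS, h⟩
        exact ⟨S, ⟨fun τ hτ => hS τ hτ, S.finite_toSet⟩, h⟩
    rw [this]
    refine MeasurableSet.iUnion fun S => MeasurableSet.inter ?_ (ih _ _)
    exact S.measurableSet_biInter fun τ _ => hT τ

/-! the sentence -/

def dns {AP : Type} : MSOL AP :=
  .exSO 0 (.not (.exFO 0 (.and (.mem 0 0) (.not (.exFO 1 (.and (.mem 1 0) (.exFO 2 (.and (.mem 2 0)
    (.and (.and (.le 0 1) (.le 0 2)) (.and (.not (.le 1 2)) (.not (.le 2 1))))))))))))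

theorem dns_sentence {AP : Type} : (dns : MSOL AP).IsSentence := by
  constructor
  · ext y; simp [dns, MSOL.freeFO]; try grind
  · simp [dns, MSOL.freeSO]

theorem dns_sat {AP : Type} (K : KripkeTree AP) : (CoWMTL AP).KSat K dns ↔
    ∃ P ⊆ K.T, IsTree P ∧ ∀ x ∈ P, ∃ y ∈ P, ∃ z ∈ P, x <+: y ∧ x <+: z ∧ ¬ y <+: z ∧ ¬ z <+: y := by
  rw [KSat_iff dns_sentence (fun _ => []) (fun _ => ∅)]
  simp only [dns, Sat, Function.update_self, ne_eq, not_false_eq_true,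
      Function.update_of_ne, zero_ne_one, one_ne_zero, OfNat.zero_ne_ofNat, OfNat.one_ne_ofNat]
  constructor
  · rintro ⟨P, hP, h⟩
    refine ⟨P, hP.1.1, hP.1.2, fun x hx => ?_⟩
    have hPT := hP.1.1
    by_contra hcon
    apply h
    refine ⟨x, hPT hx, hx, ?_⟩
    rintro ⟨y, hyT, hy, z, hzT, hz, h1, h2, h3⟩
    exact hcon ⟨y, hy, z, hz, h1.1.2.2, h1.2.2.2, fun h => h2 ⟨hyT, hzT, h⟩, fun h => h3 ⟨hzT, hyT, h⟩⟩
  · rintro ⟨P, hPT, hP, h⟩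
    refine ⟨P, ⟨⟨hPT, hP⟩, ?_⟩, ?_⟩
    · intro hfin
      obtain ⟨r, hr⟩ := hP
      obtain ⟨x, hx, hmax⟩ := Set.exists_max_image P List.length hfin ⟨r, hr.1⟩
      obtain ⟨y, hy, z, hz, h1, h2, h3, h4⟩ := h x hx
      have := h1.eq_of_length (le_antisymm h1.length_le (hmax y hy))
      subst this
      exact h3 h2
    · rintro ⟨x, hxT, hx, hcon⟩
      obtain ⟨y, hy, z, hz, h1, h2, h3, h4⟩ := h x hx
      exact hcon ⟨y, hPT hy, hy, z, hPT hz, hz, ⟨⟨hxT, hPT hy, h1⟩, ⟨hxT, hPT hz, h2⟩⟩,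
        fun h => h3 h.2.2, fun h => h4 h.2.2⟩

theorem limit_seq (s : ℕ → List ℕ) (h : ∀ n, s n <+: s (n+1)) (hl : ∀ n, n ≤ (s n).length) :
    ∃ y, ∀ n, pre y n <+: s n := by
  have hmono : ∀ m n, m ≤ n → s m <+: s n := by
    intro m n hmn
    induction hmn with
    | refl => exact List.prefix_rfl
    | step _ ih => exact ih.trans (h _)
  refine ⟨fun i => (s (i+1)).getD i 0, fun n => ?_⟩
  rw [List.prefix_iff_getElem]
  refine ⟨by simpa using hl n, fun i hi => ?_⟩
  have hi' : i < n := by simpa using hi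
  have h2 : i < (s (i+1)).length := hl (i+1)
  have := (hmono (i+1) n hi').getElem h2
  simp [pre, h2, this]

theorem zeros_comparable {w a b : List ℕ} (ha : ∀ c ∈ a, c = 0) (hb : ∀ c ∈ b, c = 0) :
    w ++ a <+: w ++ b ∨ w ++ b <+: w ++ a := by
  rw [List.eq_replicate_of_mem ha, List.eq_replicate_of_mem hb]
  simp only [List.prefix_append_right_inj]
  rcases le_total a.length b.length with h | h
  · left
    exact ⟨List.replicate (b.length - a.length) 0, by rw [← List.replicate_add]; congr 1; omega⟩
  · right
    exact ⟨List.replicate (a.length - b.length) 0, by rw [← List.replicate_add]; congr 1; omega⟩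

theorem dec_zeros (w : List ℕ) (n : ℕ) : dec (w ++ List.replicate n 0) =
    ((dec w).1, (dec w).2 + n) := by
  induction n with
  | zero => simp
  | succ n ih => rw [List.replicate_succ', ← List.append_assoc, dec_snoc, ih]; simp [step]; omega

theorem dns_ill (AP : Type) (x : ℕ → ℕ) : (CoWMTL AP).KSat (Kx AP x) dns ↔ ill x := by
  rw [dns_sat]
  constructor
  · rintro ⟨P, hPT, ⟨r, hr⟩, h⟩
    have hstep : ∀ w : P, ∃ w' : P, (dec w).1 <+: (dec w').1 ∧
        (dec w).1.length < (dec w').1.length := by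
      rintro ⟨w, hw⟩
      obtain ⟨_, hy, _, hz, ⟨a, rfl⟩, ⟨b, rfl⟩, h3, h4⟩ := h w hw
      have gen : ∀ a, w ++ a ∈ P → ¬ (∀ c ∈ a, c = 0) → ∃ w' : P, (dec w).1 <+: (dec w').1 ∧
        (dec w).1.length < (dec w').1.length := by
        intro a ha hc
        refine ⟨⟨w ++ a, ha⟩, dec_mono _ _, ?_⟩
        simp only [dec_length, List.countP_append]
        push Not at hc
        obtain ⟨c, hc, hc0⟩ := hc
        have : 0 < a.countP (· ≠ 0) := List.countP_pos_iff.2 ⟨c, hc, by simpa using hc0⟩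
        omega
      by_cases ha : ∀ c ∈ a, c = 0
      · by_cases hb : ∀ c ∈ b, c = 0
        · rcases zeros_comparable (w := w) ha hb with h | h
          · exact absurd h h3
          · exact absurd h h4
        · exact gen b hz hb
      · exact gen a hy ha
    choose g hg1 hg2 using hstep
    let sq : ℕ → P := fun n => g^[n] ⟨r, hr.1⟩
    have hsq : ∀ n, sq (n+1) = g (sq n) := fun n => Function.iterate_succ_apply' g n _
    obtain ⟨y, hy⟩ := limit_seq (fun n => (dec (sq n)).1) (fun n => by simp only [hsq]; exact hg1 _)
      (fun n => by
        induction n with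
        | zero => simp
        | succ n ih => simp only [hsq]; exact lt_of_le_of_lt ih (hg2 _))
    exact ⟨y, fun n => U_down (hPT (sq n).2).2 (hy n)⟩
  · rintro ⟨y, hy⟩
    let P : Set Node := {w | (∀ a ∈ w, a ≤ 2) ∧ (dec w).1 = pre y (dec w).1.length ∧
      (dec w).2 ≤ y (dec w).1.length}
    have hdown : ∀ w a, w ++ [a] ∈ P → w ∈ P := by
      rintro w a ⟨h1, h2, h3⟩
      refine ⟨fun b hb => h1 b (by simp [hb]), ?_⟩
      rw [dec_snoc, step] at h2 h3
      split_ifs at h2 h3 with ha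
      · exact ⟨h2, by simp at h3; omega⟩
      · simp only [List.length_append, List.length_singleton, pre_succ] at h2
        obtain ⟨e1, e2⟩ := List.append_inj h2 (by simp)
        exact ⟨e1, by simp at e2; omega⟩
    have hdown' : ∀ v w, w ++ v ∈ P → w ∈ P := by
      intro v
      induction v using List.reverseRecOn with
      | nil => simp
      | append_singleton v a ih =>
        intro w hw
        rw [← List.append_assoc] at hw
        exact ih w (hdown _ _ hw)
    refine ⟨P, ?_, ⟨[], tree_iff.2 ⟨⟨by simp, by simp [dec, pre], by simp [dec]⟩, by simp, ?_⟩⟩, ?_⟩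
    · rintro w ⟨h1, h2, _⟩
      exact ⟨h1, by rw [h2]; exact hy _⟩
    · rintro w hw v - ⟨u, rfl⟩
      exact hdown' u v hw
    · rintro w ⟨h1, h2, h3⟩
      have hin : ∀ a, a = 1 ∨ a = 2 → (w ++ List.replicate (y (dec w).1.length - (dec w).2) 0) ++ [a] ∈ P := by
        intro a ha
        have hd : dec ((w ++ List.replicate (y (dec w).1.length - (dec w).2) 0) ++ [a]) =
            (pre y ((dec w).1.length + 1), 0) := by
          rw [dec_snoc, dec_zeros, step, if_neg (by omega), pre_succ, ← h2]
          simp; omega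
        refine ⟨?_, ?_, ?_⟩
        · intro b hb
          simp only [List.mem_append, List.mem_replicate, List.mem_singleton] at hb
          rcases hb with (hb | hb) | hb
          · exact h1 b hb
          · omega
          · omega
        · rw [hd]; simp
        · rw [hd]; simp
      refine ⟨_, hin 1 (Or.inl rfl), _, hin 2 (Or.inr rfl), ?_, ?_, ?_, ?_⟩
      · rw [List.append_assoc]; exact List.prefix_append _ _
      · rw [List.append_assoc]; exact List.prefix_append _ _
      · intro h
        have := h.eq_of_length (by simp)
        simp at this
      · intro h
        have := h.eq_of_length (by simp)
        simp at this

end BorelPart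

theorem not_CoWMTL_le_WMSO (AP : Type) : ¬ MLogic.Leq (finBrKT AP) (CoWMTL AP) (WMSO AP) := by
  intro h
  obtain ⟨ψ, hψ, -, hK⟩ := h BorelPart.dns BorelPart.dns_sentence trivial
  apply BorelPart.not_measurable
  have := BorelPart.sat_measurable ψ (fun _ => []) (fun _ => ∅)
  convert this using 3 with x
  rw [← BorelPart.dns_ill AP x, hK _ (BorelPart.Kx_finBr AP x), KSat_iff hψ (fun _ => []) (fun _ => ∅)]
  rfl

set_option linter.unusedSimpArgs false

/-! ### CoWMTL is not inside MSO: a composition argument -/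

namespace FV

def nd (i : ℕ) : Option ℕ → Node
  | none => []
  | some k => i :: List.replicate k 0

def TI (I : Set ℕ) : Set Node := {w | w = [] ∨ ∃ i ∈ I, ∃ k, w = nd i (some k)}

def KI (AP : Type) (I : Set ℕ) (hI : I.Nonempty) : KripkeTree AP where
  T := TI I
  root := []
  rooted := by
    rw [tree_iff]
    refine ⟨Or.inl rfl, by simp, ?_⟩
    rintro w (rfl | ⟨i, hi, k, rfl⟩) v - hv
    · left; simpa using hv
    · rcases v with _ | ⟨j, v⟩
      · left; rfl
      · right
        simp only [nd, List.cons_prefix_cons] at hv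
        obtain ⟨rfl, hv⟩ := hv
        refine ⟨j, hi, v.length, ?_⟩
        simp only [nd, List.cons.injEq, true_and]
        rw [List.eq_replicate_iff]
        exact ⟨rfl, fun b hb => (List.mem_replicate.1 (hv.subset hb)).2⟩
  nonblocking := by
    obtain ⟨i, hi⟩ := hI
    rintro w (rfl | ⟨i, hi, k, rfl⟩)
    · exact ⟨i, Or.inr ⟨i, hi, 0, rfl⟩⟩
    · exact ⟨0, Or.inr ⟨i, hi, k+1, by simp [nd, List.replicate_succ']⟩⟩
  Lab := fun _ => ∅

/-- status of a node relative to a branch: `none` root, `some none` elsewhere,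
`some (some k)` at position `k`. -/
def st (i : ℕ) : Node → Option (Option ℕ)
  | [] => none
  | j :: l => if j = i then some (some l.length) else some none

abbrev LA : Type := (ℕ → Option (Option ℕ)) × (ℕ → Set (Option ℕ))

def loc (V1 : ℕ → Node) (V2 : ℕ → Set Node) (i : ℕ) : LA :=
  (fun x => st i (V1 x), fun X => {o | nd i o ∈ V2 X})

def Eqv {F : Type} (m : ℕ) (I : Set ℕ) (c : ℕ → F) (J : Set ℕ) (d : ℕ → F) : Prop :=
  ∀ f, min (m : ℕ∞) {i | i ∈ I ∧ c i = f}.encard = min (m : ℕ∞) {j | j ∈ J ∧ d j = f}.encard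

theorem Eqv.symm {F : Type} {m : ℕ} {I J : Set ℕ} {c d : ℕ → F} (h : Eqv m I c J d) :
    Eqv m J d I c := fun f => (h f).symm

theorem min_mono {m M : ℕ} (h : m ≤ M) {a b : ℕ∞} (hab : min (M : ℕ∞) a = min (M : ℕ∞) b) :
    min (m : ℕ∞) a = min (m : ℕ∞) b := by
  have h' : (m : ℕ∞) = min (m : ℕ∞) M := (min_eq_left (by exact_mod_cast h)).symm
  rw [h', min_assoc, min_assoc, hab]

theorem Eqv.mono {F : Type} {m M : ℕ} (hm : m ≤ M) {I J : Set ℕ} {c d : ℕ → F}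
    (h : Eqv M I c J d) : Eqv m I c J d := fun f => min_mono hm (h f)

theorem min_add (m : ℕ) {a b a' b' : ℕ∞} (h : min (m : ℕ∞) a = min (m : ℕ∞) a')
    (h' : min (m : ℕ∞) b = min (m : ℕ∞) b') : min (m : ℕ∞) (a + b) = min (m : ℕ∞) (a' + b') := by
  have key : ∀ a b : ℕ∞, min (m : ℕ∞) (a + b) = min (m : ℕ∞) (min (m : ℕ∞) a + min (m : ℕ∞) b) := by
    intro a b
    induction a using ENat.recTopCoe with
    | top => simp
    | coe a =>
      induction b using ENat.recTopCoe with
      | top => simp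
      | coe b =>
        have hmin : ∀ u v : ℕ, min (u : ℕ∞) (v : ℕ∞) = ((min u v : ℕ) : ℕ∞) := fun u v => by
          rcases le_total u v with h | h
          · rw [min_eq_left h, min_eq_left (by exact_mod_cast h)]
          · rw [min_eq_right h, min_eq_right (by exact_mod_cast h)]
        rw [hmin, hmin, ← Nat.cast_add, ← Nat.cast_add, hmin, hmin]
        congr 1; omega
  rw [key a, key a', h, h']

theorem Eqv.map {F G : Type} [Finite F] {m : ℕ} {I J : Set ℕ} {c d : ℕ → F} (g : F → G)
    (h : Eqv m I c J d) : Eqv m I (fun i => g (c i)) J (fun j => g (d j)) := by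
  classical
  have := Fintype.ofFinite F
  intro a
  have key : ∀ s : Finset F, min (m : ℕ∞) {i | i ∈ I ∧ c i ∈ s}.encard =
      min (m : ℕ∞) {j | j ∈ J ∧ d j ∈ s}.encard := by
    intro s
    induction s using Finset.induction_on with
    | empty => simp
    | insert b s hb ih =>
      have e : ∀ (I : Set ℕ) (c : ℕ → F), {i | i ∈ I ∧ c i ∈ insert b s}.encard =
          {i | i ∈ I ∧ c i = b}.encard + {i | i ∈ I ∧ c i ∈ s}.encard := by
        intro I c
        rw [← Set.encard_union_eq]
        · congr 1; ext i; simp only [Finset.mem_insert, Set.mem_ofPred_eq, Set.mem_union]; tauto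
        · rw [Set.disjoint_left]
          rintro i ⟨_, h⟩ ⟨_, h'⟩
          exact hb (h ▸ h')
      rw [e, e]
      exact min_add m (h b) ih
  simpa using key (Finset.univ.filter fun f => g f = a)

theorem Eqv.congr {F : Type} {m : ℕ} {I J : Set ℕ} {c d c' d' : ℕ → F} (h : Eqv m I c J d)
    (hc : ∀ i ∈ I, c i = c' i) (hd : ∀ j ∈ J, d j = d' j) : Eqv m I c' J d' := by
  intro f
  have e1 : {i | i ∈ I ∧ c' i = f} = {i | i ∈ I ∧ c i = f} := by
    ext i; exact and_congr_right fun hi => by rw [hc i hi]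
  have e2 : {i | i ∈ J ∧ d' i = f} = {i | i ∈ J ∧ d i = f} := by
    ext i; exact and_congr_right fun hi => by rw [hd i hi]
  rw [e1, e2]; exact h f

theorem Eqv.exists {F : Type} {m : ℕ} (hm : 1 ≤ m) {I J : Set ℕ} {c d : ℕ → F}
    (h : Eqv m I c J d) {j : ℕ} (hj : j ∈ J) : ∃ i ∈ I, c i = d j := by
  by_contra hcon
  push Not at hcon
  have e : {i | i ∈ I ∧ c i = d j} = ∅ := by
    ext i; simp; exact hcon i
  have := h (d j)
  rw [e] at this
  simp only [Set.encard_empty, min_zero, zero_le, inf_of_le_right] at this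
  have h2 : (1 : ℕ∞) ≤ min (m : ℕ∞) {j' | j' ∈ J ∧ d j' = d j}.encard := by
    refine le_min (by exact_mod_cast hm) ?_
    rw [Set.one_le_encard_iff_nonempty]
    exact ⟨j, hj, rfl⟩
  rw [← this] at h2
  simp at h2

theorem class_refine {F : Type} [Finite F] (m : ℕ) (A B : Set ℕ) (f : ℕ → F)
    (h : min ((m * Nat.card F + 1 : ℕ) : ℕ∞) A.encard =
      min ((m * Nat.card F + 1 : ℕ) : ℕ∞) B.encard) :
    ∃ g : ℕ → F, ∀ a, min (m : ℕ∞) {i | i ∈ A ∧ f i = a}.encard =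
      min (m : ℕ∞) {j | j ∈ B ∧ g j = a}.encard := by
  classical
  have := Fintype.ofFinite F
  set M := m * Nat.card F + 1 with hM
  by_cases hA : A.encard < M
  · have hAB : A.encard = B.encard := by
      rw [min_eq_right hA.le] at h
      rcases le_total (M : ℕ∞) B.encard with h' | h'
      · rw [min_eq_left h'] at h; exact absurd h hA.ne
      · rwa [min_eq_right h'] at h
    have hfA : A.Finite := Set.finite_of_encard_le_coe hA.le
    obtain ⟨e, he⟩ := hfA.exists_bijOn_of_encard_eq hAB
    refine ⟨fun j => f (Function.invFunOn e A j), fun a => ?_⟩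
    congr 1
    have : {j | j ∈ B ∧ f (Function.invFunOn e A j) = a} = e '' {i | i ∈ A ∧ f i = a} := by
      ext j
      constructor
      · rintro ⟨hj, hf⟩
        have hj' : ∃ a ∈ A, e a = j := he.surjOn hj
        exact ⟨_, ⟨Function.invFunOn_mem hj', hf⟩, Function.invFunOn_eq hj'⟩
      · rintro ⟨i, ⟨hi, hf⟩, rfl⟩
        refine ⟨he.mapsTo hi, ?_⟩
        rw [he.injOn.leftInvOn_invFunOn hi]; exact hf
    rw [this, Set.InjOn.encard_image]
    exact he.injOn.mono fun i hi => hi.1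
  · push Not at hA
    have hB : (M : ℕ∞) ≤ B.encard := by
      rw [min_eq_left hA] at h; rw [h]; exact min_le_right _ _
    -- representatives
    have hch : ∀ a, ∃ S ⊆ {i | i ∈ A ∧ f i = a},
        S.encard = min (m : ℕ∞) {i | i ∈ A ∧ f i = a}.encard := fun a =>
      Set.exists_subset_encard_eq (min_le_right _ _)
    choose S hS hSc using hch
    have hbig : ∃ a, (m : ℕ∞) ≤ {i | i ∈ A ∧ f i = a}.encard := by
      by_contra hcon
      push Not at hcon
      have hle : A.encard ≤ ∑ a : F, (m : ℕ∞) := by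
        have hAe : A = ⋃ a ∈ (Finset.univ : Finset F), {i | i ∈ A ∧ f i = a} := by
          ext i; simp
        rw [hAe]
        refine (Finset.set_encard_biUnion_le _ _).trans (Finset.sum_le_sum fun a _ => (hcon a).le)
      have := hA.trans hle
      rw [Finset.sum_const, Finset.card_univ, ← Nat.card_eq_fintype_card] at this
      simp only [nsmul_eq_mul] at this
      norm_cast at this
      rw [hM, mul_comm] at this
      omega
    obtain ⟨a₀, ha₀⟩ := hbig
    set A0 := ⋃ a ∈ (Finset.univ : Finset F), S a with hA0
    have hA0c : A0.encard ≤ B.encard := by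
      refine le_trans ?_ hB
      have h1 : A0.encard ≤ ∑ a : F, (m : ℕ∞) := by
        refine (Finset.set_encard_biUnion_le _ _).trans (Finset.sum_le_sum fun a _ => ?_)
        rw [hSc]; exact min_le_left _ _
      refine h1.trans ?_
      rw [Finset.sum_const, Finset.card_univ, ← Nat.card_eq_fintype_card]
      simp only [nsmul_eq_mul]
      norm_cast
      rw [hM, mul_comm]; omega
    have hSfin : ∀ a, (S a).Finite := fun a =>
      Set.finite_of_encard_le_coe (k := m) (by rw [hSc]; exact min_le_left _ _)
    have hA0f : A0.Finite := Set.Finite.biUnion (Finset.finite_toSet _) fun a _ => hSfin a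
    obtain ⟨B0, hB0, hB0c⟩ := Set.exists_subset_encard_eq hA0c
    obtain ⟨e, he⟩ := hA0f.exists_bijOn_of_encard_eq hB0c.symm
    have hinv : ∀ i ∈ A0, Function.invFunOn e A0 (e i) = i := fun i hi =>
      he.injOn.leftInvOn_invFunOn hi
    refine ⟨fun j => if j ∈ B0 then f (Function.invFunOn e A0 j) else a₀, fun a => ?_⟩
    have hSA : S a ⊆ A0 := fun i hi => Set.mem_biUnion (Finset.mem_coe.2 (Finset.mem_univ a)) hi
    have hsub : e '' S a ⊆ {j | j ∈ B ∧ (if j ∈ B0 then f (Function.invFunOn e A0 j) else a₀) = a} := by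
      rintro _ ⟨i, hi, rfl⟩
      have : e i ∈ B0 := he.mapsTo (hSA hi)
      refine ⟨hB0 this, ?_⟩
      rw [if_pos this, hinv i (hSA hi)]
      exact (hS a hi).2
    have hcard : (e '' S a).encard = (S a).encard := (he.injOn.mono hSA).encard_image
    by_cases haa : a = a₀
    · subst haa
      rw [min_eq_left ha₀, min_eq_left]
      have h1 := hSc a
      rw [min_eq_left ha₀] at h1
      rw [← h1, ← hcard]
      exact Set.encard_le_encard hsub
    · have : {j | j ∈ B ∧ (if j ∈ B0 then f (Function.invFunOn e A0 j) else a₀) = a} = e '' S a := by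
        refine Set.Subset.antisymm ?_ hsub
        rintro j ⟨hj, hja⟩
        split_ifs at hja with hj0
        · obtain ⟨i, hi, rfl⟩ := he.surjOn hj0
          rw [hinv i hi] at hja
          refine ⟨i, ?_, rfl⟩
          simp only [hA0, Set.mem_iUnion] at hi
          obtain ⟨b, _, hb⟩ := hi
          have := (hS b hb).2
          rw [hja] at this; rw [this]; exact hb
        · exact absurd hja.symm haa
      rw [this, hcard, hSc]
      simp

theorem refine_eqv {F F' : Type} [Finite F] (m : ℕ) {I J : Set ℕ} {c d : ℕ → F'} (f : ℕ → F)
    (h : Eqv (m * Nat.card F + 1) I c J d) :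
    ∃ g : ℕ → F, Eqv m I (fun i => (c i, f i)) J (fun j => (d j, g j)) := by
  have := fun q => class_refine m {i | i ∈ I ∧ c i = q} {j | j ∈ J ∧ d j = q} f (h q)
  choose g hg using this
  refine ⟨fun j => g (d j) j, ?_⟩
  rintro ⟨q, a⟩
  have e1 : {i | i ∈ I ∧ (c i, f i) = (q, a)} = {i | i ∈ {i | i ∈ I ∧ c i = q} ∧ f i = a} := by
    ext i; simp [and_assoc]
  have e2 : {j | j ∈ J ∧ (d j, g (d j) j) = (q, a)} =
      {j | j ∈ {j | j ∈ J ∧ d j = q} ∧ g q j = a} := by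
    ext j
    simp only [Prod.mk.injEq, Set.mem_ofPred_eq, and_assoc]
    refine and_congr_right fun _ => and_congr_right fun h => by rw [h]
  rw [e1, e2]; exact hg q a

def Good {AP : Type} (φ : MSOL AP) : Prop :=
  ∃ (F : Type) (_ : Finite F) (col : LA → F) (m : ℕ), ∀ (I J : Set ℕ) (hI : I.Nonempty)
    (hJ : J.Nonempty) (V1 W1 : ℕ → Node) (V2 W2 : ℕ → Set Node), (∀ x, V1 x ∈ TI I) →
    (∀ x, W1 x ∈ TI J) → Eqv m I (fun i => col (loc V1 V2 i)) J (fun j => col (loc W1 W2 j)) →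
    Sat MSOdom (KI AP I hI) V1 V2 φ → Sat MSOdom (KI AP J hJ) W1 W2 φ

theorem good_local {AP : Type} {φ : MSOL AP} (P : LA → Prop)
    (h : ∀ (I : Set ℕ) (hI : I.Nonempty) (V1 : ℕ → Node) (V2 : ℕ → Set Node), (∀ x, V1 x ∈ TI I) →
      (Sat MSOdom (KI AP I hI) V1 V2 φ ↔ ∃ i ∈ I, P (loc V1 V2 i))) : Good φ := by
  refine ⟨Prop, inferInstance, P, 1, ?_⟩
  intro I J hI hJ V1 W1 V2 W2 hV hW he hs
  rw [h I hI V1 V2 hV] at hs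
  rw [h J hJ W1 W2 hW]
  obtain ⟨i, hi, hP⟩ := hs
  obtain ⟨j, hj, hj'⟩ := he.symm.exists le_rfl hi
  exact ⟨j, hj, by rw [hj']; exact hP⟩

theorem st_nd (i j k : ℕ) : st i (nd j (some k)) = if j = i then some (some k) else some none := by
  simp [st, nd]

theorem good_le {AP : Type} (x y : ℕ) : Good (.le x y : MSOL AP) := by
  refine good_local (fun c => c.1 x = none ∨ ∃ k l, c.1 x = some (some k) ∧ c.1 y = some (some l) ∧
    k ≤ l) ?_
  intro I hI V1 V2 hV
  have hx := hV x
  have hy := hV y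
  simp only [Sat, KI, hx, hy, true_and, loc]
  rcases hx with hx | ⟨i, hi, k, hx⟩
  · simp [hx, st]; exact hI
  · rw [hx]
    rcases hy with hy | ⟨i', hi', l, hy⟩
    · rw [hy]; simp [st, nd]; intro j hj; split_ifs <;> simp
    · rw [hy]
      constructor
      · intro h
        simp only [nd, List.cons_prefix_cons] at h
        obtain ⟨rfl, h⟩ := h
        exact ⟨i, hi, Or.inr ⟨k, l, by simp [st_nd], by simp [st_nd], by simpa using h.length_le⟩⟩
      · rintro ⟨j, hj, h | ⟨k', l', h1, h2, h3⟩⟩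
        · simp only [st_nd] at h; split_ifs at h
        · simp only [st_nd] at h1 h2
          have e1 : i = j := by
            by_contra hc; rw [if_neg hc] at h1; simp at h1
          have e2 : i' = j := by
            by_contra hc; rw [if_neg hc] at h2; simp at h2
          rw [if_pos e1] at h1
          rw [if_pos e2] at h2
          subst e1; subst e2
          simp only [Option.some.injEq] at h1 h2
          subst h1; subst h2
          simp only [nd, List.cons_prefix_cons, true_and]
          exact ⟨List.replicate (l - k) 0, by rw [← List.replicate_add]; congr 1; omega⟩

theorem good_mem {AP : Type} (x X : ℕ) : Good (.mem x X : MSOL AP) := by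
  refine good_local (fun c => ∃ o, c.1 x = o.map some ∧ o ∈ c.2 X) ?_
  intro I hI V1 V2 hV
  simp only [Sat, loc]
  rcases hV x with hx | ⟨i, hi, k, hx⟩
  · rw [hx]
    constructor
    · intro h; obtain ⟨i, hi⟩ := hI; exact ⟨i, hi, none, rfl, h⟩
    · rintro ⟨i, hi, o, h1, h2⟩
      rcases o with _ | o
      · exact h2
      · simp [st] at h1
  · rw [hx]
    constructor
    · intro h; exact ⟨i, hi, some k, by simp [st_nd], h⟩
    · rintro ⟨j, hj, o, h1, h2⟩
      rw [st_nd] at h1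
      rcases o with _ | o
      · split_ifs at h1 <;> simp at h1
      · split_ifs at h1 with e
        · subst e; simp at h1; subst h1; exact h2
        · simp at h1

theorem loc_updFO (V1 : ℕ → Node) (V2 : ℕ → Set Node) (x : ℕ) (τ : Node) (i : ℕ) :
    loc (Function.update V1 x τ) V2 i =
      (Function.update (loc V1 V2 i).1 x (st i τ), (loc V1 V2 i).2) := by
  simp only [loc, Prod.mk.injEq, and_true]
  funext y
  by_cases h : y = x
  · subst h; simp
  · simp [Function.update_of_ne h]

theorem loc_updSO (V1 : ℕ → Node) (V2 : ℕ → Set Node) (X : ℕ) (S : Set Node) (i : ℕ) :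
    loc V1 (Function.update V2 X S) i =
      ((loc V1 V2 i).1, Function.update (loc V1 V2 i).2 X {o | nd i o ∈ S}) := by
  simp only [loc, Prod.mk.injEq, true_and]
  funext y
  by_cases h : y = X
  · subst h; simp
  · simp [Function.update_of_ne h]

theorem upd_mem {I : Set ℕ} {V1 : ℕ → Node} (h : ∀ x, V1 x ∈ TI I) {x : ℕ} {τ : Node}
    (hτ : τ ∈ TI I) : ∀ y, Function.update V1 x τ y ∈ TI I := by
  intro y
  by_cases h' : y = x
  · subst h'; simpa using hτ
  · simpa [Function.update_of_ne h'] using h y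

theorem good_exSO {AP : Type} (X : ℕ) {φ : MSOL AP} (h : Good φ) : Good (.exSO X φ) := by
  obtain ⟨F, hF, col, m, h⟩ := h
  refine ⟨Prop → Set F, inferInstance, fun c b => {a | ∃ S : Set (Option ℕ), (none ∈ S ↔ b) ∧
    col (c.1, Function.update c.2 X S) = a}, (m + 1) * Nat.card F + 1, ?_⟩
  intro I J hI hJ V1 W1 V2 W2 hV hW he
  rintro ⟨S, hS, hs⟩
  obtain ⟨g, hg⟩ := refine_eqv (m + 1) (fun i => col (loc V1 (Function.update V2 X S) i)) he
  have hex : ∀ j, ∃ S' : Set (Option ℕ), j ∈ J → (none ∈ S' ↔ [] ∈ S) ∧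
      col ((loc W1 W2 j).1, Function.update (loc W1 W2 j).2 X S') = g j := by
    intro j
    by_cases hj : j ∈ J
    · obtain ⟨i, hi, hi'⟩ := hg.exists (by omega) hj
      simp only [Prod.mk.injEq] at hi'
      obtain ⟨e1, e2⟩ := hi'
      have : g j ∈ {a | ∃ S' : Set (Option ℕ), (none ∈ S' ↔ ([] ∈ S)) ∧
          col ((loc V1 V2 i).1, Function.update (loc V1 V2 i).2 X S') = a} := by
        refine ⟨{o | nd i o ∈ S}, Iff.rfl, ?_⟩
        rw [← e2, loc_updSO]
      have e3 := congrFun e1 ([] ∈ S)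
      rw [e3] at this
      obtain ⟨S', h1, h2⟩ := this
      exact ⟨S', fun _ => ⟨h1, h2⟩⟩
    · exact ⟨∅, fun h => absurd h hj⟩
  choose S' hS' using hex
  refine ⟨{w | (w = [] ∧ [] ∈ S) ∨ ∃ j ∈ J, ∃ k, w = nd j (some k) ∧ some k ∈ S' j}, ?_, ?_⟩
  · rintro w (⟨rfl, _⟩ | ⟨j, hj, k, rfl, _⟩)
    · exact Or.inl rfl
    · exact Or.inr ⟨j, hj, k, rfl⟩
  · refine h I J hI hJ V1 W1 (Function.update V2 X S) _ hV hW ?_ hs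
    have hg' := (hg.map Prod.snd).mono (Nat.le_succ m)
    refine hg'.congr (fun _ _ => rfl) ?_
    intro j hj
    simp only
    rw [loc_updSO, ← (hS' j hj).2]
    congr 3
    ext o
    rcases o with _ | k
    · simp [nd, (hS' j hj).1]
    · simp only [Set.mem_ofPred_eq]
      constructor
      · intro h; exact Or.inr ⟨j, hj, k, rfl, h⟩
      · rintro (⟨h, _⟩ | ⟨j', hj', k', h1, h2⟩)
        · simp [nd] at h
        · simp only [nd, List.cons.injEq] at h1
          obtain ⟨rfl, h1⟩ := h1
          have := congrArg List.length h1
          simp at this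
          subst this; exact h2

theorem good_exFO {AP : Type} (x : ℕ) {φ : MSOL AP} (h : Good φ) : Good (.exFO x φ) := by
  classical
  obtain ⟨F, hF, col, m, h⟩ := h
  refine ⟨F × F × Set F, inferInstance, fun c => (col (Function.update c.1 x none, c.2),
    col (Function.update c.1 x (some none), c.2),
    {a | ∃ k, col (Function.update c.1 x (some (some k)), c.2) = a}),
    (m + 2) * Nat.card (F × Prop) + 1, ?_⟩
  intro I J hI hJ V1 W1 V2 W2 hV hW he
  rintro ⟨τ, hτ, hs⟩
  rcases id hτ with rfl | ⟨i0, hi0, k, rfl⟩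
  · refine ⟨[], Or.inl rfl, ?_⟩
    refine h I J hI hJ _ _ V2 W2 (upd_mem hV hτ) (upd_mem hW (Or.inl rfl)) ?_ hs
    have hle : m ≤ (m + 2) * Nat.card (F × Prop) + 1 := by
      have : 0 < Nat.card (F × Prop) := by
        have : Nonempty F := ⟨col (fun _ => none, fun _ => ∅)⟩
        exact Nat.card_pos
      nlinarith
    refine ((he.map Prod.fst).mono hle).congr ?_ ?_ <;> intro i _ <;> simp only [loc_updFO] <;> rfl
  · obtain ⟨g, hg⟩ := refine_eqv (F := F × Prop) (m + 2)
      (fun i => (col (loc (Function.update V1 x (nd i0 (some k))) V2 i), i = i0)) he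
    have hone : {j | j ∈ J ∧ (g j).2 = True}.encard = 1 := by
      have h1 := ((hg.map (fun p => p.2.2)).mono (show 2 ≤ m + 2 by omega)) True
      have e : {i | i ∈ I ∧ (i = i0) = True} = {i0} := by
        ext i; simp; rintro rfl; exact hi0
      simp only [e, Set.encard_singleton] at h1
      generalize {j | j ∈ J ∧ (g j).2 = True}.encard = z at h1 ⊢
      induction z using ENat.recTopCoe with
      | top => simp at h1
      | coe z =>
        have h3 : ((z : ℕ) : ℕ∞) = ((1 : ℕ) : ℕ∞) := by
          rcases le_total (2 : ℕ) z with h | h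
          · have h' : ((2:ℕ) : ℕ∞) ≤ (z : ℕ∞) := by exact_mod_cast h
            rw [min_eq_left h', min_eq_right (by norm_num)] at h1
            norm_num at h1
          · have h' : (z : ℕ∞) ≤ ((2:ℕ) : ℕ∞) := by exact_mod_cast h
            rw [min_eq_right h', min_eq_right (by norm_num)] at h1
            simpa using h1.symm
        simpa using h3
    rw [Set.encard_eq_one] at hone
    obtain ⟨j0, hj0⟩ := hone
    have hj0' : j0 ∈ {j | j ∈ J ∧ (g j).2 = True} := by rw [hj0]; rfl
    obtain ⟨hj0J, hgj0⟩ := hj0'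
    obtain ⟨i, hi, hii⟩ := hg.exists (by omega) hj0J
    simp only [Prod.mk.injEq] at hii
    have hii0 : i = i0 := by
      have := congrArg Prod.snd hii.2
      simp only [hgj0] at this
      simpa using this
    subst hii0
    obtain ⟨⟨-, -, e3⟩, e4⟩ := hii
    have hk : (g j0).1 ∈ {a | ∃ k, col (Function.update (loc W1 W2 j0).1 x (some (some k)),
        (loc W1 W2 j0).2) = a} := by
      rw [← e3, ← e4]
      exact ⟨k, by rw [loc_updFO, st_nd, if_pos rfl]⟩
    obtain ⟨k', hk'⟩ := hk
    have hτ' : nd j0 (some k') ∈ TI J := Or.inr ⟨j0, hj0J, k', rfl⟩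
    refine ⟨nd j0 (some k'), hτ', ?_⟩
    refine h I J hI hJ _ _ V2 W2 (upd_mem hV hτ) (upd_mem hW hτ') ?_ hs
    refine ((hg.map (fun p => p.2.1)).mono (show m ≤ m + 2 by omega)).congr (fun _ _ => rfl) ?_
    intro j hj
    simp only
    rw [loc_updFO, st_nd]
    by_cases hjj : j0 = j
    · subst hjj; rw [if_pos rfl, hk']
    · rw [if_neg hjj]
      obtain ⟨i', hi', hii'⟩ := hg.exists (by omega) hj
      simp only [Prod.mk.injEq] at hii'
      obtain ⟨⟨-, f2, -⟩, f4⟩ := hii'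
      have hne : i' ≠ i := by
        rintro rfl
        have := congrArg Prod.snd f4
        have hmem : j ∈ {j | j ∈ J ∧ (g j).2 = True} := ⟨hj, by rw [← this]; simp⟩
        rw [hj0] at hmem
        exact hjj hmem.symm
      rw [← f2, ← f4, loc_updFO, st_nd, if_neg hne.symm]

theorem good_and {AP : Type} {φ ψ : MSOL AP} (h : Good φ) (h' : Good ψ) : Good (.and φ ψ) := by
  obtain ⟨F, hF, col, m, h⟩ := h
  obtain ⟨F', hF', col', m', h'⟩ := h'
  refine ⟨F × F', inferInstance, fun c => (col c, col' c), max m m', ?_⟩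
  intro I J hI hJ V1 W1 V2 W2 hV hW he hs
  exact ⟨h I J hI hJ V1 W1 V2 W2 hV hW ((he.map Prod.fst).mono (le_max_left _ _)) hs.1,
    h' I J hI hJ V1 W1 V2 W2 hV hW ((he.map Prod.snd).mono (le_max_right _ _)) hs.2⟩

theorem good_not {AP : Type} {φ : MSOL AP} (h : Good φ) : Good (.not φ) := by
  obtain ⟨F, hF, col, m, h⟩ := h
  refine ⟨F, hF, col, m, ?_⟩
  intro I J hI hJ V1 W1 V2 W2 hV hW he hs hs'
  exact hs (h J I hJ hI W1 V1 W2 V2 hW hV he.symm hs')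

theorem good {AP : Type} (φ : MSOL AP) : Good φ := by
  induction φ with
  | atom a x => exact good_local (fun _ => False) (by intros; simp [Sat, KI])
  | le x y => exact good_le x y
  | mem x X => exact good_mem x X
  | not φ ih => exact good_not ih
  | and φ ψ ih ih' => exact good_and ih ih'
  | exFO x φ ih => exact good_exFO x ih
  | exSO X φ ih => exact good_exSO X ih

def infb {AP : Type} : MSOL AP :=
  .exSO 0 (.exFO 0 (.not (.exFO 1 (.and (.mem 1 0) (.exFO 2 (.and (.le 2 1)
    (.and (.not (.le 1 2)) (.not (.le 2 0)))))))))

theorem infb_sentence {AP : Type} : (infb : MSOL AP).IsSentence := by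
  constructor
  · ext y; simp [infb, MSOL.freeFO]; try grind
  · simp [infb, MSOL.freeSO]

theorem infb_univ (AP : Type) : (CoWMTL AP).KSat (KI AP Set.univ Set.univ_nonempty) infb := by
  rw [KSat_iff infb_sentence (fun _ => []) (fun _ => ∅)]
  simp only [infb, Sat, Function.update_self, ne_eq, not_false_eq_true,
      Function.update_of_ne, zero_ne_one, one_ne_zero, OfNat.zero_ne_ofNat, OfNat.one_ne_ofNat]
  refine ⟨{w | w = [] ∨ ∃ i : ℕ, w = [i]}, ⟨⟨?_, [], ?_⟩, ?_⟩, [], Or.inl rfl, ?_⟩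
  · rintro w (rfl | ⟨i, rfl⟩)
    · exact Or.inl rfl
    · exact Or.inr ⟨i, trivial, 0, rfl⟩
  · rw [tree_iff]
    refine ⟨Or.inl rfl, by simp, ?_⟩
    rintro w (rfl | ⟨i, rfl⟩) y _ hy
    · left; simpa using hy
    · rw [List.prefix_cons_iff] at hy
      rcases hy with rfl | ⟨t, rfl, ht⟩
      · exact Or.inl rfl
      · right; exact ⟨i, by simpa using ht⟩
  · refine Set.infinite_of_injective_forall_mem (f := fun i : ℕ => [i]) ?_ ?_
    · intro i j h; simpa using h
    · intro i; exact Or.inr ⟨i, rfl⟩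
  · rintro ⟨y, hyT, hy, z, hzT, h1, h2, h3⟩
    have hz : z ≠ [] := by
      rintro rfl; exact h3 ⟨hzT, Or.inl rfl, List.prefix_rfl⟩
    rcases hy with rfl | ⟨i, rfl⟩
    · exact hz (by simpa using h1.2.2)
    · have h12 := h1.2.2
      rw [List.prefix_cons_iff] at h12
      rcases h12 with rfl | ⟨t, rfl, ht⟩
      · exact hz rfl
      · have : t = [] := by simpa using ht
        subst this
        exact h2 ⟨hyT, hyT, List.prefix_rfl⟩

theorem infb_fin (AP : Type) (n : ℕ) (hn : (Set.Iio n).Nonempty) :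
    ¬ (CoWMTL AP).KSat (KI AP (Set.Iio n) hn) infb := by
  rw [KSat_iff infb_sentence (fun _ => []) (fun _ => ∅)]
  simp only [infb, Sat, Function.update_self, ne_eq, not_false_eq_true,
      Function.update_of_ne, zero_ne_one, one_ne_zero, OfNat.zero_ne_ofNat, OfNat.one_ne_ofNat]
  rintro ⟨X, hX, r, hr, h⟩
  apply hX.2
  have hfin : (insert [] ((fun p : ℕ × ℕ => nd p.1 (some p.2)) ''
      (Set.Iio n ×ˢ Set.Iio (r.length + 1)))).Finite :=
    (((Set.finite_Iio n).prod (Set.finite_Iio _)).image _).insert _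
  refine hfin.subset ?_
  intro y hy
  have hyT := hX.1.1 hy
  rcases id hyT with rfl | ⟨i, hi, k, rfl⟩
  · exact Or.inl rfl
  · right
    refine ⟨(i, k), ⟨hi, ?_⟩, rfl⟩
    simp only [Set.mem_Iio]
    rcases k with _ | k
    · omega
    · by_contra hk
      apply h
      have hzT : nd i (some k) ∈ (KI AP (Set.Iio n) hn).T := Or.inr ⟨i, hi, k, rfl⟩
      refine ⟨_, hyT, hy, nd i (some k), hzT, ⟨hzT, hyT, ?_⟩, ?_, ?_⟩
      · simp only [nd, List.cons_prefix_cons, true_and]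
        exact ⟨[0], by simp [List.replicate_succ']⟩
      · intro h
        have := h.2.2.length_le
        simp [nd] at this
      · intro h
        have := h.2.2.length_le
        simp [nd] at this
        omega

end FV

theorem not_CoWMTL_le_MSO (AP : Type) : ¬ MLogic.Leq (allKT AP) (CoWMTL AP) (MSO AP) := by
  intro h
  obtain ⟨ψ, hψ, -, hK⟩ := h FV.infb FV.infb_sentence trivial
  obtain ⟨F, hF, col, m, hG⟩ := FV.good ψ
  have hn : (Set.Iio (m+1)).Nonempty := ⟨0, by simp⟩
  apply FV.infb_fin AP (m+1) hn
  rw [hK _ trivial, KSat_iff hψ (fun _ => []) (fun _ => ∅)]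
  have h1 := FV.infb_univ AP
  rw [hK _ trivial, KSat_iff hψ (fun _ => []) (fun _ => ∅)] at h1
  refine hG Set.univ _ _ hn _ _ _ _ (fun _ => Or.inl rfl) (fun _ => Or.inl rfl) ?_ h1
  intro f
  have e : ∀ i, FV.loc (fun _ => []) (fun _ => ∅) i = FV.loc (fun _ => []) (fun _ => ∅) 0 := by
    intro i; simp [FV.loc, FV.st]
  simp only [e]
  by_cases hf : col (FV.loc (fun _ => []) (fun _ => ∅) 0) = f
  · simp only [hf, and_true, Set.ofPred_mem_eq]
    rw [min_eq_left (by simp), min_eq_left]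
    rw [(Set.finite_Iio _).encard_eq_coe_toFinset_card]
    simp
  · simp [hf]

set_option linter.unusedSimpArgs false

/-! ### WMSO and MSO are not inside CoWMTL -/

namespace YT

def nd (n : ℕ) (s : Bool) (h : ℕ) : Node :=
  (List.range h).map fun i => if s = true ∧ i = n then 1 else 0

def val (n : ℕ) (s : Bool) (h : ℕ) : Prop := s = false ∨ n < h

theorem nd_length (n : ℕ) (s : Bool) (h : ℕ) : (nd n s h).length = h := by simp [nd]

theorem nd_succ (n : ℕ) (s : Bool) (h : ℕ) :
    nd n s (h+1) = nd n s h ++ [if s = true ∧ h = n then 1 else 0] := by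
  simp [nd, List.range_succ]

theorem prefix_iff {n : ℕ} {s t : Bool} {i j : ℕ} (hs : val n s i) (ht : val n t j) :
    nd n s i <+: nd n t j ↔ i ≤ j ∧ (s = t ∨ i ≤ n) := by
  rw [List.prefix_iff_getElem]
  simp only [nd_length]
  constructor
  · rintro ⟨h, h'⟩
    refine ⟨h, ?_⟩
    by_contra hc
    push Not at hc
    have := h' n (by simpa [nd_length] using hc.2)
    simp [nd] at this
    cases s <;> cases t <;> simp_all
  · rintro ⟨h, h'⟩
    refine ⟨h, ?_⟩
    intro k hk
    simp only [nd, List.getElem_map, List.getElem_range]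
    rcases h' with rfl | h'
    · rfl
    · rw [if_neg, if_neg] <;> omega

theorem nd_inj {n : ℕ} {s t : Bool} {i j : ℕ} (hs : val n s i) (ht : val n t j)
    (h : nd n s i = nd n t j) : s = t ∧ i = j := by
  have h1 : i = j := by simpa [nd_length] using congrArg List.length h
  have h2 := ((prefix_iff hs ht).1 (h ▸ List.prefix_rfl)).2
  have h3 := ((prefix_iff ht hs).1 (h ▸ List.prefix_rfl)).2
  refine ⟨?_, h1⟩
  subst h1
  rcases h2 with h2 | h2
  · exact h2
  · rcases hs with rfl | hs
    · rcases ht with rfl | ht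
      · rfl
      · omega
    · omega

def TY (n : ℕ) : Set Node := {w | ∃ s h, val n s h ∧ w = nd n s h}

theorem nd_any (n : ℕ) (s : Bool) (h : ℕ) : nd n s h ∈ TY n := by
  by_cases hh : n < h
  · exact ⟨s, h, Or.inr hh, rfl⟩
  · refine ⟨false, h, Or.inl rfl, ?_⟩
    simp only [nd]
    apply List.map_congr_left
    intro i hi
    rw [List.mem_range] at hi
    rw [if_neg, if_neg] <;> simp; omega

theorem prefix_nd {n : ℕ} {s : Bool} {h : ℕ} {v : Node} (hv : v <+: nd n s h) :
    v = nd n s v.length := by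
  have hl := hv.length_le
  rw [nd_length] at hl
  rw [List.prefix_iff_eq_take] at hv
  rw [hv]
  simp [nd, ← List.map_take, List.take_range, hl]

def KY (AP : Type) (n : ℕ) : KripkeTree AP where
  T := TY n
  root := []
  rooted := by
    rw [tree_iff]
    refine ⟨⟨false, 0, Or.inl rfl, rfl⟩, by simp, ?_⟩
    rintro w ⟨s, h, hv, rfl⟩ v - hv
    rw [prefix_nd hv]; exact nd_any _ _ _
  nonblocking := by
    rintro w ⟨s, h, hv, rfl⟩
    refine ⟨if s = true ∧ h = n then 1 else 0, ?_⟩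
    rw [← nd_succ]; exact nd_any _ _ _
  Lab := fun _ => ∅

theorem KY_fin (AP : Type) (n : ℕ) : KY AP n ∈ finBrKT AP := by
  rintro w -
  refine Set.Finite.subset (s := {nd n false (w.length + 1), nd n true (w.length+1)}) (by simp) ?_
  rintro v ⟨⟨s, h, hv, rfl⟩, k, hk⟩
  have := congrArg List.length hk
  simp only [nd_length, List.length_append, List.length_cons, List.length_nil, zero_add] at this
  subst this
  cases s <;> simp

/-! the game -/

def clamp (N : ℕ) (z : ℤ) : ℤ := max (-(N:ℤ)) (min N z)

def EE (N : ℕ) (R : ℕ → ℕ → Prop) : Prop :=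
  ∀ p q p' q', R p q → R p' q' → clamp N ((p:ℤ) - p') = clamp N ((q:ℤ) - q')

def ext (R : ℕ → ℕ → Prop) (a a' : ℕ) : ℕ → ℕ → Prop := fun p q => (p = a ∧ q = a') ∨ R p q

theorem EE.mono {N M : ℕ} (h : N ≤ M) {R} (hR : EE M R) : EE N R := by
  intro p q p' q' h1 h2
  have := hR p q p' q' h1 h2
  simp only [clamp] at *
  omega

theorem EE_ext {N : ℕ} {R : ℕ → ℕ → Prop} {a a' : ℕ} (hR : EE N R)
    (h : ∀ p q, R p q → clamp N ((a:ℤ) - p) = clamp N ((a':ℤ) - q)) : EE N (ext R a a') := by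
  rintro p q p' q' (⟨rfl, rfl⟩ | h1) (⟨rfl, rfl⟩ | h2)
  · simp
  · exact h _ _ h2
  · have := h _ _ h1
    simp only [clamp] at *
    omega
  · exact hR _ _ _ _ h1 h2

theorem EE_step {N : ℕ} {R : ℕ → ℕ → Prop} (hR : EE (2 * N) R) (h0 : R 0 0) (a : ℕ) :
    ∃ a', EE N (ext R a a') := by
  classical
  have hRN : EE N R := hR.mono (by omega)
  by_cases hc : ∃ p q, R p q ∧ |(a:ℤ) - p| ≤ N
  · obtain ⟨p, q, hpq, hle⟩ := hc
    rw [abs_le] at hle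
    have h1 := hR _ _ _ _ hpq h0
    simp only [clamp] at h1
    refine ⟨((q:ℤ) + (a - p)).toNat, EE_ext hRN ?_⟩
    have hnn : 0 ≤ ((q:ℤ) + (a - p)) := by omega
    intro p1 q1 h2
    have h3 := hR _ _ _ _ hpq h2
    rw [Int.toNat_of_nonneg hnn]
    simp only [clamp] at *
    omega
  · push Not at hc
    have hex : ∃ p, (∃ q, R p q ∧ p < a) ∧ ∀ p1 q1, R p1 q1 → p1 < a → p1 ≤ p := by
      let P : ℕ → Prop := fun p => ∃ q, R p q ∧ p < a
      have hP0 : P 0 := by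
        refine ⟨0, h0, ?_⟩
        have := hc 0 0 h0
        by_contra hcon
        have : a = 0 := by omega
        subst this
        simp at this
        simp at *
        omega
      refine ⟨Nat.findGreatest P a, Nat.findGreatest_spec (P := P) (Nat.zero_le a) hP0, ?_⟩
      intro p1 q1 h1 h2
      exact Nat.le_findGreatest h2.le ⟨q1, h1, h2⟩
    obtain ⟨p, ⟨q, hpq, hpa⟩, hmax⟩ := hex
    refine ⟨q + N, EE_ext hRN ?_⟩
    intro p1 q1 h1
    have h2 := hc _ _ h1
    have h2' := hc _ _ hpq
    rw [lt_abs] at h2 h2'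
    have h3 := hR _ _ _ _ hpq h1
    have h4 := hmax p1 q1 h1
    simp only [clamp] at *
    push_cast at *
    omega

def Cmp (R : ℕ → ℕ → Prop) (h h' : ℕ) : Prop := ∀ p q, R p q → (h < p ↔ h' < q) ∧ (p < h ↔ q < h')

theorem EE.cmp {N : ℕ} (hN : 1 ≤ N) {R : ℕ → ℕ → Prop} (hR : EE N R) {h h' : ℕ} (hh : R h h') :
    Cmp R h h' := by
  intro p q hpq
  have := hR _ _ _ _ hh hpq
  simp only [clamp] at this
  omega

structure Inv (N n n' : ℕ) (R : ℕ → ℕ → Prop) (V1 W1 : ℕ → Node) (V2 W2 : ℕ → Set Node) : Prop where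
  ee : EE N R
  z : R 0 0
  b : R n n'
  fo : ∀ x, ∃ s h h', val n s h ∧ val n' s h' ∧ R h h' ∧ V1 x = nd n s h ∧ W1 x = nd n' s h'
  so : ∀ X s h h', Cmp R h h' → val n s h → val n' s h' → (nd n s h ∈ V2 X ↔ nd n' s h' ∈ W2 X)

theorem Inv.symm {N n n' : ℕ} {R V1 W1 V2 W2} (h : Inv N n n' R V1 W1 V2 W2) :
    Inv N n' n (fun p q => R q p) W1 V1 W2 V2 where
  ee := fun p q p' q' h1 h2 => (h.ee _ _ _ _ h1 h2).symm
  z := h.z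
  b := h.b
  fo := fun x => by
    obtain ⟨s, i, i', h1, h2, h3, h4, h5⟩ := h.fo x
    exact ⟨s, i', i, h2, h1, h3, h5, h4⟩
  so := fun X s i i' h1 h2 h3 =>
    (h.so X s i' i (fun p q hpq => ⟨(h1 q p hpq).1.symm, (h1 q p hpq).2.symm⟩) h3 h2).symm

theorem val_cmp {n n' : ℕ} {R : ℕ → ℕ → Prop} (hb : R n n') {s h h'} (hc : Cmp R h h')
    (hv : val n s h) : val n' s h' := by
  rcases hv with hv | hv
  · exact Or.inl hv
  · exact Or.inr ((hc _ _ hb).2.1 hv)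

theorem Inv.mono {N M n n' : ℕ} (hNM : M ≤ N) {R V1 W1 V2 W2} (h : Inv N n n' R V1 W1 V2 W2) :
    Inv M n n' R V1 W1 V2 W2 := ⟨h.ee.mono hNM, h.z, h.b, h.fo, h.so⟩

theorem Inv.ext {N n n' : ℕ} {R V1 W1 V2 W2} (h : Inv (2 * N) n n' R V1 W1 V2 W2) (a : ℕ) :
    ∃ a', Inv N n n' (ext R a a') V1 W1 V2 W2 := by
  obtain ⟨a', ha'⟩ := EE_step h.ee h.z a
  refine ⟨a', ha', Or.inr h.z, Or.inr h.b, ?_, ?_⟩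
  · intro x
    obtain ⟨s, i, i', h1, h2, h3, h4⟩ := h.fo x
    exact ⟨s, i, i', h1, h2, Or.inr h3, h4⟩
  · intro X s i i' h1
    exact h.so X s i i' fun p q hpq => h1 p q (Or.inr hpq)

theorem Inv.updFO {N n n' : ℕ} {R V1 W1 V2 W2} (h : Inv N n n' R V1 W1 V2 W2) (x : ℕ)
    {s : Bool} {i i' : ℕ} (h1 : val n s i) (h2 : val n' s i') (h3 : R i i') :
    Inv N n n' R (Function.update V1 x (nd n s i)) (Function.update W1 x (nd n' s i')) V2 W2 := by
  refine ⟨h.ee, h.z, h.b, ?_, h.so⟩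
  intro y
  by_cases hy : y = x
  · subst hy; exact ⟨s, i, i', h1, h2, h3, by simp, by simp⟩
  · simpa [Function.update_of_ne hy] using h.fo y

/-! infinite subtrees -/

def mk (n : ℕ) (s : Bool) (r : ℕ) (e : Bool → Option ℕ) : Set Node :=
  {w | ∃ t h, val n t h ∧ r ≤ h ∧ (s = t ∨ r ≤ n) ∧ (∀ b ∈ e t, h ≤ b) ∧ w = nd n t h}

theorem nd_mem_mk {n : ℕ} {s : Bool} {r : ℕ} {e : Bool → Option ℕ} {t h} (hv : val n t h) :
    nd n t h ∈ mk n s r e ↔ r ≤ h ∧ (s = t ∨ r ≤ n) ∧ (∀ b ∈ e t, h ≤ b) := by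
  constructor
  · rintro ⟨t', h', hv', h1, h2, h3, h4⟩
    obtain ⟨rfl, rfl⟩ := nd_inj hv hv' h4
    exact ⟨h1, h2, h3⟩
  · rintro ⟨h1, h2, h3⟩
    exact ⟨t, h, hv, h1, h2, h3, rfl⟩

structure Ok (n : ℕ) (s : Bool) (r : ℕ) (e : Bool → Option ℕ) : Prop where
  v : val n s r
  re : ∀ b ∈ e s, r ≤ b
  br : r ≤ n → (∀ b ∈ e false, n ≤ b) ∨ ∃ b ∈ e true, b ≤ n
  inf : ∃ t, e t = none ∧ (s = t ∨ r ≤ n)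

theorem Ok.mem {n s r e} (h : Ok n s r e) : YT.mk n s r e ∈ coweakDom MTLdom (TY n) := by
  refine ⟨⟨?_, nd n s r, ?_⟩, ?_⟩
  · rintro w ⟨t, i, hv, -, -, -, rfl⟩; exact ⟨t, i, hv, rfl⟩
  · rw [tree_iff]
    refine ⟨(nd_mem_mk h.v).2 ⟨le_rfl, Or.inl rfl, h.re⟩, ?_, ?_⟩
    · rintro w ⟨t, i, hv, h1, h2, h3, rfl⟩
      rw [prefix_iff h.v hv]
      exact ⟨h1, h2⟩
    · rintro w ⟨t, i, hv, h1, h2, h3, rfl⟩ y hy1 hy2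
      have hyT : y ∈ TY n := by rw [prefix_nd hy2]; exact nd_any _ _ _
      obtain ⟨u, j, hu, rfl⟩ := hyT
      rw [prefix_iff h.v hu] at hy1
      rw [prefix_iff hu hv] at hy2
      rw [nd_mem_mk hu]
      refine ⟨hy1.1, hy1.2, ?_⟩
      intro b hb
      rcases hy2.2 with rfl | hjn
      · exact hy2.1.trans (h3 b hb)
      · have hu' : u = false := by
          rcases hu with hu | hu
          · exact hu
          · omega
        subst hu'
        rcases Bool.eq_false_or_eq_true t with ht | ht
        · subst ht
          rcases h.br (hy1.1.trans hjn) with h4 | ⟨b', hb', hb''⟩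
          · exact hjn.trans (h4 b hb)
          · have := h3 b' hb'
            rcases hv with hv | hv
            · simp at hv
            · omega
        · subst ht; exact hy2.1.trans (h3 b hb)
  · obtain ⟨t, ht, hs⟩ := h.inf
    refine Set.infinite_of_injective_forall_mem (f := fun k : ℕ => nd n t (n + 1 + r + k)) ?_ ?_
    · intro i j hij
      have := congrArg List.length hij
      simpa [nd_length] using this
    · intro k
      rw [nd_mem_mk (Or.inr (by omega))]
      exact ⟨by omega, hs, by simp [ht]⟩

theorem exists_ok {n : ℕ} {S : Set Node} (hS : S ∈ coweakDom MTLdom (TY n)) :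
    ∃ s r e, Ok n s r e ∧ S = mk n s r e := by
  classical
  obtain ⟨⟨hST, ρ, hρ⟩, hinf⟩ := hS
  rw [tree_iff] at hρ
  obtain ⟨hr, hroot, hdown⟩ := hρ
  obtain ⟨s, r, hv, rfl⟩ := hST hr
  have hdown' : ∀ t h u j, val n t h → val n u j → nd n t h ∈ S → r ≤ j → (s = u ∨ r ≤ n) →
      j ≤ h → (u = t ∨ j ≤ n) → nd n u j ∈ S := by
    intro t h u j h1 h2 h3 h4 h5 h6 h7
    exact hdown _ h3 _ ((prefix_iff hv h2).2 ⟨h4, h5⟩) ((prefix_iff h2 h1).2 ⟨h6, h7⟩)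
  have hroot' : ∀ t h, val n t h → nd n t h ∈ S → r ≤ h ∧ (s = t ∨ r ≤ n) := fun t h h1 h2 =>
    (prefix_iff hv h1).1 (hroot _ h2)
  have hex : ∀ t, ∃ o : Option ℕ, ∀ h, val n t h → r ≤ h → (s = t ∨ r ≤ n) →
      ((∃ h2, h ≤ h2 ∧ nd n t h2 ∈ S) ↔ ∀ b ∈ o, h ≤ b) := by
    intro t
    by_cases hb : ∃ B, ∀ h, val n t h → nd n t h ∈ S → h ≤ B
    · obtain ⟨B, hB⟩ := hb
      by_cases hne : ∃ h, val n t h ∧ nd n t h ∈ S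
      · obtain ⟨h0, h0v, h0S⟩ := hne
        let P : ℕ → Prop := fun h => val n t h ∧ nd n t h ∈ S
        have hsp : P (Nat.findGreatest P B) := Nat.findGreatest_spec (P := P) (hB h0 h0v h0S) ⟨h0v, h0S⟩
        refine ⟨some (Nat.findGreatest P B), ?_⟩
        intro h hv1 h1 h2
        simp only [Option.mem_def, Option.some.injEq, forall_eq']
        constructor
        · rintro ⟨h3, h4, h5⟩
          have h3v : val n t h3 := by
            rcases hv1 with hv1 | hv1
            · exact Or.inl hv1
            · exact Or.inr (by omega)
          exact h4.trans (Nat.le_findGreatest (P := P) (hB _ h3v h5) ⟨h3v, h5⟩)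
        · intro h3
          exact ⟨_, h3, hsp.2⟩
      · refine ⟨some 0, ?_⟩
        intro h hv1 h1 h2
        push Not at hne
        simp only [Option.mem_def, Option.some.injEq, forall_eq']
        constructor
        · rintro ⟨h3, h4, h5⟩
          have h3v : val n t h3 := by
            rcases hv1 with hv1 | hv1
            · exact Or.inl hv1
            · exact Or.inr (by omega)
          exact absurd h5 (hne _ h3v)
        · intro h3
          have h0 : h = 0 := by omega
          have r0 : r = 0 := by omega
          subst h0; subst r0
          have : nd n t 0 ∈ S := by simpa [nd] using hr
          exact ⟨0, le_rfl, this⟩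
    · push Not at hb
      refine ⟨none, ?_⟩
      intro h hv1 h1 h2
      simp only [Option.mem_def, reduceCtorEq, false_implies, implies_true, iff_true]
      obtain ⟨h3, -, h4, h5⟩ := hb h
      exact ⟨h3, h5.le, h4⟩
  choose e he using hex
  have hval : ∀ t h h2, val n t h → h ≤ h2 → val n t h2 := by
    intro t h h2 h3 h4
    rcases h3 with h3 | h3
    · exact Or.inl h3
    · exact Or.inr (by omega)
  refine ⟨s, r, e, ⟨hv, ?_, ?_, ?_⟩, ?_⟩
  · exact (he s r hv le_rfl (Or.inl rfl)).1 ⟨r, le_rfl, hr⟩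
  · intro hrn
    by_cases h : ∃ h, val n true h ∧ nd n true h ∈ S
    · left
      obtain ⟨h, h1, h2⟩ := h
      have h1' : n < h := by simpa [val] using h1
      refine (he false n (Or.inl rfl) hrn (Or.inr hrn)).1 ⟨n, le_rfl, ?_⟩
      exact hdown' true h false n h1 (Or.inl rfl) h2 hrn (Or.inr hrn) h1'.le (Or.inr le_rfl)
    · right
      have := he true (n+1) (Or.inr (by omega)) (by omega) (Or.inr hrn)
      have hn : ¬ ∃ h2, n + 1 ≤ h2 ∧ nd n true h2 ∈ S := by
        rintro ⟨h2, h3, h4⟩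
        exact h ⟨h2, Or.inr (by omega), h4⟩
      rw [this] at hn
      push Not at hn
      obtain ⟨b, hb, hb'⟩ := hn
      exact ⟨b, hb, by omega⟩
  · by_contra hcon
    push Not at hcon
    apply hinf
    have hbd : ∀ t, ∃ B, ∀ h, val n t h → nd n t h ∈ S → h < B := by
      intro t
      rcases ho : e t with _ | b
      · refine ⟨0, fun h h1 h2 => ?_⟩
        have := hcon t ho
        have h3 := (hroot' t h h1 h2).2
        exfalso
        rcases h3 with h3 | h3
        · exact this.1 h3
        · omega
      · refine ⟨b + 1, fun h h1 h2 => ?_⟩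
        have h3 := hroot' t h h1 h2
        have := (he t h h1 h3.1 h3.2).1 ⟨h, le_rfl, h2⟩ b ho
        omega
    choose B hB using hbd
    refine Set.Finite.subset ((Set.finite_Iio (B true)).image (nd n true) |>.union
      ((Set.finite_Iio (B false)).image (nd n false))) ?_
    intro w hw
    obtain ⟨t, h, hv1, rfl⟩ := hST hw
    have := hB t h hv1 hw
    cases t
    · right; exact ⟨h, this, rfl⟩
    · left; exact ⟨h, this, rfl⟩
  · ext w
    constructor
    · intro hw
      obtain ⟨t, h, hv1, rfl⟩ := hST hw
      have h3 := hroot' t h hv1 hw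
      rw [nd_mem_mk hv1]
      exact ⟨h3.1, h3.2, (he t h hv1 h3.1 h3.2).1 ⟨h, le_rfl, hw⟩⟩
    · rintro ⟨t, h, hv1, h1, h2, h3, rfl⟩
      obtain ⟨h4, h5, h6⟩ := (he t h hv1 h1 h2).2 h3
      exact hdown' t h4 t h (hval _ _ _ hv1 h5) hv1 h6 h1 h2 h5 (Or.inl rfl)

def oR (R : ℕ → ℕ → Prop) : Option ℕ → Option ℕ → Prop
  | none, none => True
  | some a, some b => R a b
  | _, _ => False

theorem oR_bound {R : ℕ → ℕ → Prop} {o o' : Option ℕ} (h : oR R o o') {i i' : ℕ} (hc : Cmp R i i') :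
    (∀ b ∈ o, i ≤ b) ↔ ∀ b ∈ o', i' ≤ b := by
  rcases o with _ | a <;> rcases o' with _ | b <;> simp [oR] at h ⊢
  have := hc _ _ h
  omega

theorem Ok.transfer {n n' : ℕ} {s : Bool} {r r' : ℕ} {e e' : Bool → Option ℕ}
    {R : ℕ → ℕ → Prop} (hR : ∀ p q, R p q → Cmp R p q) (hb : R n n') (hr : R r r')
    (he : ∀ t, oR R (e t) (e' t)) (h : Ok n s r e) : Ok n' s r' e' := by
  have hrn : r ≤ n ↔ r' ≤ n' := by
    have := hR _ _ hr _ _ hb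
    omega
  refine ⟨val_cmp hb (hR _ _ hr) h.v, (oR_bound (he s) (hR _ _ hr)).1 h.re, ?_, ?_⟩
  · intro h1
    rcases h.br (hrn.2 h1) with h2 | ⟨b, h2, h3⟩
    · exact Or.inl ((oR_bound (he false) (hR _ _ hb)).1 h2)
    · right
      have h4 := he true
      rw [Option.mem_def] at h2
      rw [h2] at h4
      rcases ho : e' true with _ | b'
      · rw [ho] at h4; exact h4.elim
      · rw [ho] at h4
        refine ⟨b', rfl, ?_⟩
        have := hR _ _ hb _ _ h4
        omega
  · obtain ⟨t, h1, h2⟩ := h.inf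
    refine ⟨t, ?_, by rwa [← hrn]⟩
    have := he t
    rw [h1] at this
    rcases ho : e' t with _ | b'
    · rfl
    · rw [ho] at this; exact this.elim

theorem mk_cmp {n n' : ℕ} {s : Bool} {r r' : ℕ} {e e' : Bool → Option ℕ}
    {R : ℕ → ℕ → Prop} (hR : ∀ p q, R p q → Cmp R p q) (hb : R n n') (hr : R r r')
    (he : ∀ t, oR R (e t) (e' t)) {t i i'} (hc : Cmp R i i') (h1 : val n t i) (h2 : val n' t i') :
    nd n t i ∈ mk n s r e ↔ nd n' t i' ∈ mk n' s r' e' := by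
  rw [nd_mem_mk h1, nd_mem_mk h2, oR_bound (he t) hc]
  have a1 := hR _ _ hr _ _ hb
  have a2 := hc _ _ hr
  have b1 : r ≤ i ↔ r' ≤ i' := by omega
  have b2 : r ≤ n ↔ r' ≤ n' := by omega
  rw [b1, b2]

theorem Inv.exto {N n n' : ℕ} {R V1 W1 V2 W2} (h : Inv (2 * N) n n' R V1 W1 V2 W2) (o : Option ℕ) :
    ∃ o' R', Inv N n n' R' V1 W1 V2 W2 ∧ oR R' o o' ∧ ∀ p q, R p q → R' p q := by
  rcases o with _ | a
  · exact ⟨none, R, h.mono (by omega), trivial, fun _ _ h => h⟩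
  · obtain ⟨a', ha⟩ := h.ext a
    exact ⟨some a', _, ha, Or.inl ⟨rfl, rfl⟩, fun _ _ h => Or.inr h⟩

theorem oR_mono {R R' : ℕ → ℕ → Prop} (h : ∀ p q, R p q → R' p q) {o o'} (ho : oR R o o') :
    oR R' o o' := by
  rcases o with _ | a <;> rcases o' with _ | b <;> simp [oR] at ho ⊢
  exact h _ _ ho

def cost {AP : Type} : MSOL AP → ℕ
  | .atom _ _ => 0
  | .le _ _ => 0
  | .mem _ _ => 0
  | .not φ => cost φ
  | .and φ ψ => max (cost φ) (cost ψ)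
  | .exFO _ φ => cost φ + 1
  | .exSO _ φ => cost φ + 3

theorem transfer {AP : Type} (φ : MSOL AP) : ∀ (n n' : ℕ) R V1 W1 V2 W2,
    Inv (2 ^ cost φ) n n' R V1 W1 V2 W2 → Sat (coweakDom MTLdom) (KY AP n) V1 V2 φ →
    Sat (coweakDom MTLdom) (KY AP n') W1 W2 φ := by
  induction φ with
  | atom a x => intro n n' R V1 W1 V2 W2 h hs; exact absurd hs.2 (by simp [KY])
  | le x y =>
    intro n n' R V1 W1 V2 W2 h hs
    obtain ⟨s, i, i', h1, h2, h3, h4, h5⟩ := h.fo x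
    obtain ⟨t, j, j', k1, k2, k3, k4, k5⟩ := h.fo y
    have hp := hs.2.2
    rw [h4, k4, prefix_iff h1 k1] at hp
    refine ⟨⟨s, i', h2, h5⟩, ⟨t, j', k2, k5⟩, ?_⟩
    rw [h5, k5, prefix_iff h2 k2]
    have c := h.ee.cmp (by simp [cost]) h3
    have c1 := c _ _ k3
    have c2 := c _ _ h.b
    exact ⟨by omega, hp.2.imp id (by omega)⟩
  | mem x X =>
    intro n n' R V1 W1 V2 W2 h hs
    obtain ⟨s, i, i', h1, h2, h3, h4, h5⟩ := h.fo x
    simp only [Sat] at hs ⊢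
    rw [h4] at hs
    rw [h5]
    exact (h.so X s i i' (h.ee.cmp (by simp [cost]) h3) h1 h2).1 hs
  | not φ ih => intro n n' R V1 W1 V2 W2 h hs hs'; exact hs (ih _ _ _ _ _ _ _ h.symm hs')
  | and φ ψ ih ih' =>
    intro n n' R V1 W1 V2 W2 h hs
    exact ⟨ih _ _ _ _ _ _ _ (h.mono (Nat.pow_le_pow_right (by norm_num) (le_max_left _ _))) hs.1,
      ih' _ _ _ _ _ _ _ (h.mono (Nat.pow_le_pow_right (by norm_num) (le_max_right _ _))) hs.2⟩
  | exFO x φ ih =>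
    intro n n' R V1 W1 V2 W2 h
    rintro ⟨τ, ⟨s, i, hv, rfl⟩, hs⟩
    have h' : Inv (2 * 2 ^ cost φ) n n' R V1 W1 V2 W2 := by
      have e : 2 * 2 ^ cost φ = 2 ^ cost (MSOL.exFO x φ) := by simp only [cost]; ring
      rw [e]; exact h
    obtain ⟨i', hi⟩ := h'.ext i
    have hc := hi.ee.cmp (Nat.one_le_two_pow) (Or.inl ⟨rfl, rfl⟩ : YT.ext R i i' i i')
    have hv' := val_cmp hi.b hc hv
    exact ⟨nd n' s i', ⟨s, i', hv', rfl⟩, ih _ _ _ _ _ _ _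
      (hi.updFO x hv hv' (Or.inl ⟨rfl, rfl⟩)) hs⟩
  | exSO X φ ih =>
    intro n n' R V1 W1 V2 W2 h
    rintro ⟨S, hS, hs⟩
    obtain ⟨s, r, e, hok, rfl⟩ := exists_ok hS
    have h' : Inv (2 * (2 * (2 * 2 ^ cost φ))) n n' R V1 W1 V2 W2 := by
      have e : 2 * (2 * (2 * 2 ^ cost φ)) = 2 ^ cost (MSOL.exSO X φ) := by simp only [cost]; ring
      rw [e]; exact h
    obtain ⟨r', h1⟩ := h'.ext r
    have hr1 : YT.ext R r r' r r' := Or.inl ⟨rfl, rfl⟩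
    obtain ⟨e0, R2, h2, ho2, m2⟩ := h1.exto (e false)
    obtain ⟨e1, R3, h3, ho3, m3⟩ := h2.exto (e true)
    have hR : ∀ p q, R3 p q → Cmp R3 p q := fun p q hpq => h3.ee.cmp Nat.one_le_two_pow hpq
    have hr : R3 r r' := m3 _ _ (m2 _ _ hr1)
    let e' : Bool → Option ℕ := fun t => if t = true then e1 else e0
    have he : ∀ t, oR R3 (e t) (e' t) := by
      intro t
      cases t
      · exact oR_mono m3 ho2
      · exact ho3
    refine ⟨mk n' s r' e', (hok.transfer hR h3.b hr he).mem, ?_⟩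
    refine ih _ _ _ _ _ _ _ (⟨h3.ee, h3.z, h3.b, h3.fo, ?_⟩ : Inv _ n n' R3 V1 W1 _ _) hs
    intro Y t i i' hc hv1 hv2
    by_cases hY : Y = X
    · subst hY
      simp only [Function.update_self]
      exact mk_cmp hR h3.b hr he hc hv1 hv2
    · simp only [Function.update_of_ne hY]
      exact h3.so Y t i i' hc hv1 hv2

theorem indist {AP : Type} (φ : MSOL AP) (hφ : φ.IsSentence) (n : ℕ) (hn : 2 ^ cost φ ≤ n) :
    (CoWMTL AP).KSat (KY AP (n + 1)) φ ↔ (CoWMTL AP).KSat (KY AP n) φ := by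
  rw [KSat_iff hφ (fun _ => []) (fun _ => ∅), KSat_iff hφ (fun _ => []) (fun _ => ∅)]
  have : Inv (2 ^ cost φ) (n+1) n (fun p q => (p = 0 ∧ q = 0) ∨ (p = n + 1 ∧ q = n))
      (fun _ => []) (fun _ => []) (fun _ => ∅) (fun _ => ∅) := by
    refine ⟨?_, Or.inl ⟨rfl, rfl⟩, Or.inr ⟨rfl, rfl⟩, ?_, by simp⟩
    · generalize 2 ^ cost φ = N at hn
      rintro p q p' q' (⟨rfl, rfl⟩ | ⟨rfl, rfl⟩) (⟨rfl, rfl⟩ | ⟨rfl, rfl⟩) <;>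
        simp only [clamp] <;> push_cast <;> omega
    · intro x
      exact ⟨false, 0, 0, Or.inl rfl, Or.inl rfl, Or.inl ⟨rfl, rfl⟩, by simp [nd], by simp [nd]⟩
  exact ⟨transfer φ _ _ _ _ _ _ _ this, transfer φ _ _ _ _ _ _ _ this.symm⟩

/-! parity sentence -/

/-- `x` covered by `y` -/
def cov {AP : Type} (x y z : ℕ) : MSOL AP :=
  .and (.and (.le x y) (.not (.le y x)))
    (.not (.exFO z (.and (.and (.le x z) (.not (.le z x))) (.and (.le z y) (.not (.le y z))))))

def par {AP : Type} : MSOL AP :=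
  .exFO 0 (.exFO 1 (.exFO 2 (.exSO 0
    (.and (.and (.and (.le 0 1) (.le 0 2)) (.and (.not (.le 1 2)) (.not (.le 2 1))))
    (.and (.not (.exFO 3 (.and (.and (.le 3 1) (.le 3 2)) (.not (.le 3 0)))))
    (.and (.mem 0 0)
    (.and (.exFO 3 (.and (.mem 3 0) (.not (.exFO 4 (.not (.le 3 4))))))
    (.not (.exFO 3 (.exFO 4 (.and (.and (.le 4 0) (cov 3 4 5))
      (.not (.and (.not (.and (.mem 3 0) (.mem 4 0)))
        (.not (.and (.not (.mem 3 0)) (.not (.mem 4 0)))))))))))))))))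

theorem par_sentence {AP : Type} : (par : MSOL AP).IsSentence := by
  constructor
  · ext y; simp [par, cov, MSOL.freeFO]; try grind
  · simp [par, cov, MSOL.freeSO]

set_option maxHeartbeats 1000000 in
theorem par_iff {AP : Type} (L : MLogic AP) (hL : L.dom = MSOdom ∨ L.dom = weakDom MSOdom) (n : ℕ) :
    L.KSat (KY AP n) par ↔ Even n := by
  rw [KSat_iff par_sentence (fun _ => []) (fun _ => ∅)]
  simp only [par, cov, Sat, Function.update_self, ne_eq, not_false_eq_true,
      Function.update_of_ne, zero_ne_one, one_ne_zero, OfNat.zero_ne_ofNat, OfNat.one_ne_ofNat,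
      OfNat.ofNat_ne_zero, OfNat.ofNat_ne_one, Nat.reduceEqDiff]
  constructor
  · rintro ⟨b, hb, y, hy, z, hz, X, hX, ⟨⟨h1, h2⟩, h3, h4⟩, h5, h6, ⟨r, hr, hrX, h7⟩, h8⟩
    have hT : ∀ s i, nd n s i ∈ (KY AP n).T := nd_any n
    obtain ⟨s, i, hv, rfl⟩ := id hb
    obtain ⟨t, j, hvt, rfl⟩ := id hy
    obtain ⟨u, k, hvu, rfl⟩ := id hz
    have h3' : ¬ (j ≤ k ∧ (t = u ∨ j ≤ n)) := fun h => h3 ⟨hT _ _, hT _ _, (prefix_iff hvt hvu).2 h⟩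
    have h4' : ¬ (k ≤ j ∧ (u = t ∨ k ≤ n)) := fun h => h4 ⟨hT _ _, hT _ _, (prefix_iff hvu hvt).2 h⟩
    have h1' := (prefix_iff hv hvt).1 h1.2.2
    have h2' := (prefix_iff hv hvu).1 h2.2.2
    have htu : t ≠ u := by
      rintro rfl
      simp only [true_or, and_true] at h3' h4'
      omega
    have htu' : u ≠ t := htu.symm
    simp only [htu, htu', false_or] at h3' h4'
    have hin : i ≤ n := by
      rcases h1'.2 with rfl | h
      · exact h2'.2.resolve_left htu
      · exact h
    have hs : s = false := by
      rcases hv with h | h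
      · exact h
      · omega
    subst hs
    have hv0 : ∀ i, val n false i := fun i => Or.inl rfl
    have hni : n ≤ i := by
      by_contra hc
      apply h5
      refine ⟨nd n false n, hT _ _, ⟨⟨hT _ _, hT _ _, ?_⟩, ⟨hT _ _, hT _ _, ?_⟩⟩, ?_⟩
      · rw [prefix_iff (hv0 n) hvt]; exact ⟨by omega, Or.inr le_rfl⟩
      · rw [prefix_iff (hv0 n) hvu]; exact ⟨by omega, Or.inr le_rfl⟩
      · rintro ⟨_, _, h⟩
        rw [prefix_iff (hv0 n) hv] at h
        omega
    have hii : i = n := by omega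
    subst hii
    have hr0 : r = nd i false 0 := by
      by_contra hc
      apply h7
      refine ⟨nd i false 0, hT _ _, ?_⟩
      rintro ⟨_, _, h⟩
      apply hc
      simpa [nd] using h
    have key : ∀ l, l ≤ i → (nd i false l ∈ X ↔ Even l) := by
      intro l
      induction l with
      | zero => intro _; rw [hr0] at hrX; simp [hrX]
      | succ l ih =>
        intro hl
        have ih := ih (by omega)
        by_contra hcon
        apply h8
        refine ⟨nd i false l, hT _ _, nd i false (l+1), hT _ _, ⟨⟨hT _ _, hT _ _, ?_⟩,
          ⟨⟨hT _ _, hT _ _, ?_⟩, ?_⟩, ?_⟩, ?_⟩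
        · rw [prefix_iff (hv0 _) (hv0 _)]; exact ⟨hl, Or.inl rfl⟩
        · rw [prefix_iff (hv0 _) (hv0 _)]; exact ⟨by omega, Or.inl rfl⟩
        · rintro ⟨_, _, h⟩
          rw [prefix_iff (hv0 _) (hv0 _)] at h; omega
        · rintro ⟨w, hw, ⟨⟨_, _, a1⟩, a2⟩, ⟨_, _, a3⟩, a4⟩
          have b1 : w ≠ nd i false l := by
            rintro rfl; exact a2 ⟨hT _ _, hT _ _, List.prefix_rfl⟩
          have b2 : w ≠ nd i false (l+1) := by
            rintro rfl; exact a4 ⟨hT _ _, hT _ _, List.prefix_rfl⟩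
          have c1 := a1.length_le
          have c3 := a3.length_le
          have c := prefix_nd a3
          rw [nd_length] at c1 c3
          rcases (by omega : w.length = l ∨ w.length = l + 1) with h | h
          · rw [h] at c; exact b1 c
          · rw [h] at c; exact b2 c
        · rw [ih]
          rw [Nat.even_add_one] at hcon
          clear * - hcon
          tauto
    exact (key i le_rfl).1 h6
  · intro hn
    have hT : ∀ s i, nd n s i ∈ (KY AP n).T := nd_any n
    have hv0 : ∀ i, val n false i := fun i => Or.inl rfl
    have hv1 : val n true (n+1) := Or.inr (by omega)
    have hX : ∀ i, i ≤ n → (nd n false i ∈ {w | ∃ i, i ≤ n ∧ Even i ∧ w = nd n false i} ↔ Even i) := by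
      intro i hi
      constructor
      · rintro ⟨j, hj, he, h⟩
        rw [(nd_inj (hv0 i) (hv0 j) h).2]; exact he
      · intro he; exact ⟨i, hi, he, rfl⟩
    refine ⟨nd n false n, hT _ _, nd n false (n+1), hT _ _, nd n true (n+1), hT _ _,
      {w | ∃ i, i ≤ n ∧ Even i ∧ w = nd n false i}, ?_, ⟨⟨⟨hT _ _, hT _ _, ?_⟩, ⟨hT _ _, hT _ _, ?_⟩⟩, ?_, ?_⟩,
      ?_, ⟨n, le_rfl, hn, rfl⟩, ⟨nd n false 0, hT _ _, ⟨0, by omega, by simp, rfl⟩, ?_⟩, ?_⟩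
    · have hsub : {w | ∃ i, i ≤ n ∧ Even i ∧ w = nd n false i} ⊆ (KY AP n).T := by
        rintro w ⟨i, -, -, rfl⟩; exact hT _ _
      have hfin : {w | ∃ i, i ≤ n ∧ Even i ∧ w = nd n false i}.Finite := by
        refine ((Set.finite_Iic n).image (nd n false)).subset ?_
        rintro w ⟨i, hi, -, rfl⟩; exact ⟨i, hi, rfl⟩
      rcases hL with h | h <;> rw [h]
      · exact hsub
      · exact ⟨hsub, hfin⟩
    · rw [prefix_iff (hv0 _) (hv0 _)]; simp
    · rw [prefix_iff (hv0 _) hv1]; simp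
    · rintro ⟨_, _, h⟩
      rw [prefix_iff (hv0 _) hv1] at h; simp at h
    · rintro ⟨_, _, h⟩
      rw [prefix_iff hv1 (hv0 _)] at h; simp at h
    · rintro ⟨w, ⟨s, i, hv, rfl⟩, ⟨⟨_, _, h1⟩, ⟨_, _, h2⟩⟩, h3⟩
      rw [prefix_iff hv (hv0 _)] at h1
      rw [prefix_iff hv hv1] at h2
      apply h3
      refine ⟨hT _ _, hT _ _, ?_⟩
      rw [prefix_iff hv (hv0 _)]
      cases s <;> simp_all
    · rintro ⟨w, hw, h⟩
      exact h ⟨hT _ _, hw, by simp [nd]⟩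
    · rintro ⟨x, hx, y, hy, ⟨⟨_, _, h1⟩, ⟨⟨_, _, h2⟩, h3⟩, h4⟩, h5⟩
      have e1 := prefix_nd h1
      have e2 := prefix_nd (h2.trans h1)
      have l1 := h1.length_le
      rw [nd_length] at l1
      generalize y.length = j at *
      generalize x.length = i at *
      subst e1; subst e2
      rw [prefix_iff (hv0 _) (hv0 _)] at h2
      have hij : i ≠ j := by
        rintro rfl
        exact h3 ⟨hT _ _, hT _ _, List.prefix_rfl⟩
      have hj : j = i + 1 := by
        by_contra hc
        apply h4
        refine ⟨nd n false (i+1), hT _ _, ⟨⟨hT _ _, hT _ _, ?_⟩, ?_⟩, ⟨hT _ _, hT _ _, ?_⟩, ?_⟩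
        · rw [prefix_iff (hv0 _) (hv0 _)]; exact ⟨by omega, Or.inl rfl⟩
        · rintro ⟨_, _, h⟩
          rw [prefix_iff (hv0 _) (hv0 _)] at h; omega
        · rw [prefix_iff (hv0 _) (hv0 _)]; exact ⟨by omega, Or.inl rfl⟩
        · rintro ⟨_, _, h⟩
          rw [prefix_iff (hv0 _) (hv0 _)] at h; omega
      subst hj
      rw [hX i (by omega), hX (i+1) l1, Nat.even_add_one] at h5
      clear * - h5
      tauto

theorem not_le {AP : Type} (M : Set (KripkeTree AP)) (hM : ∀ n, KY AP n ∈ M) (L : MLogic AP)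
    (hs : ∀ φ, L.syn φ) (hL : L.dom = MSOdom ∨ L.dom = weakDom MSOdom) :
    ¬ MLogic.Leq M L (CoWMTL AP) := by
  intro h
  obtain ⟨ψ, hψ, -, hK⟩ := h par par_sentence (hs _)
  have h1 := hK _ (hM (2 ^ cost ψ + 1))
  have h2 := hK _ (hM (2 ^ cost ψ))
  rw [par_iff L hL, indist ψ hψ _ le_rfl, ← h2, par_iff L hL, Nat.even_add_one] at h1
  tauto

end YT

theorem not_WMSO_le_CoWMTL (AP : Type) : ¬ MLogic.Leq (finBrKT AP) (WMSO AP) (CoWMTL AP) :=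
  YT.not_le _ (YT.KY_fin AP) _ (fun _ => trivial) (Or.inr rfl)

theorem not_MSO_le_CoWMTL (AP : Type) : ¬ MLogic.Leq (finBrKT AP) (MSO AP) (CoWMTL AP) :=
  YT.not_le _ (YT.KY_fin AP) _ (fun _ => trivial) (Or.inl rfl)

/-- over all Kripke trees, MTL < CoWMTL, WMTL < CoWMTL,
MSO ≁ CoWMTL, WMSO ≁ CoWMTL; over finitely-branching Kripke trees,
MTL ≡ CoWMTL, WMTL < CoWMTL, and WMSO ≁ CoWMTL. -/
theorem stmt14 (AP : Type) [Fintype AP] :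
    MLogic.Lt (allKT AP) (MTL AP) (CoWMTL AP) ∧
    MLogic.Lt (allKT AP) (WMTL AP) (CoWMTL AP) ∧
    MLogic.Incomp (allKT AP) (MSO AP) (CoWMTL AP) ∧
    MLogic.Incomp (allKT AP) (WMSO AP) (CoWMTL AP) ∧
    MLogic.EquivExp (finBrKT AP) (MTL AP) (CoWMTL AP) ∧
    MLogic.Lt (finBrKT AP) (WMTL AP) (CoWMTL AP) ∧
    MLogic.Incomp (finBrKT AP) (WMSO AP) (CoWMTL AP) := by
  have hsub : finBrKT AP ⊆ allKT AP := Set.subset_univ _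
  refine ⟨⟨MTL_le_CoWMTL _, fun h => not_CoWMTL_le_MSO AP (Leq_trans h (MTL_le_MSO _))⟩,
    ⟨WMTL_le_CoWMTL _, fun h => not_CoWMTL_le_WMSO AP
      (Leq_mono hsub (Leq_trans h (WMTL_le_WMSO _)))⟩,
    ⟨fun h => not_MSO_le_CoWMTL AP (Leq_mono hsub h), not_CoWMTL_le_MSO AP⟩,
    ⟨fun h => not_WMSO_le_CoWMTL AP (Leq_mono hsub h),
      fun h => not_CoWMTL_le_WMSO AP (Leq_mono hsub h)⟩,
    ⟨MTL_le_CoWMTL _, CoWMTL_le_MTL AP⟩,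
    ⟨WMTL_le_CoWMTL _, fun h => not_CoWMTL_le_WMSO AP (Leq_trans h (WMTL_le_WMSO _))⟩,
    ⟨not_WMSO_le_CoWMTL AP, not_CoWMTL_le_WMSO AP⟩⟩
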